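/- (Two-loop watermelon with three independent masses.) Let d be real with 1 < d < 3 and d ≠ 2, set δ = (d−1)/2, and let λ, ν, κ > 0 be real such that κ ≠ δ + λ + ν + 2k for every natural number k. Then the two-loop banana integral converges and (2·π^(d/2)/Γ(d/2)) · ∫₁^∞ G(d,λ,u)·G(d,ν,u)·G(d,κ,u)·(u²−1)^((d−2)/2) du = Σ_{k=0}^∞ ρ(d,k,λ,ν) · ( Γ(1−d/2) / (2^d·π^(d/2)·((δ+2k+λ+ν)² − κ²)) ) · ( Γ((d−1)/2+κ)/Γ((3−d)/2+κ) − Γ(d−1+2k+λ+ν)/Γ(1+2k+λ+ν) ), the series on the right converging absolutely. -/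

import Mathlib

open MeasureTheory Real Filter

/-- The AdS propagator, defined for real parameters `d`, `μ` and real `u > 1` by its
hypergeometric series. -/
noncomputable def adsG (d μ u : ℝ) : ℝ :=
  Real.Gamma ((d - 1) / 2 + μ) /
      (2 * Real.pi ^ ((d - 1) / 2) * Real.Gamma (μ + 1) * (2 * u) ^ ((d - 1) / 2 + μ)) *
    ∑' n : ℕ,
      (ascPochhammer ℝ n).eval ((d - 1) / 4 + μ / 2) *
          (ascPochhammer ℝ n).eval ((d + 1) / 4 + μ / 2) /
          ((ascPochhammer ℝ n).eval (μ + 1) * (n.factorial : ℝ)) *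
        u ^ (-(2 : ℝ) * n)

/-- The Källén–Lehmann weight `ρ(d,k,λ,ν)`. -/
noncomputable def klWeight (d : ℝ) (k : ℕ) (l v : ℝ) : ℝ :=
  (2 * ((d - 1) / 2) + 4 * k + 2 * l + 2 * v) * Real.Gamma (1 + 2 * k + l + v) /
      (4 * Real.pi ^ ((d - 1) / 2) * Real.Gamma ((d - 1) / 2) *
        Real.Gamma (2 * ((d - 1) / 2) + 2 * k + l + v)) *
    (Real.Gamma ((d - 1) / 2 + k) * Real.Gamma ((d - 1) / 2 + l + k) *
        Real.Gamma ((d - 1) / 2 + v + k) * Real.Gamma ((d - 1) / 2 + l + v + k) /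
      (Real.Gamma (1 + k) * Real.Gamma (1 + l + k) * Real.Gamma (1 + v + k) *
        Real.Gamma (1 + l + v + k)))

/-- The coefficient of `u ^ (-(δ + μ + 2 n))` in the propagator, where `δ = (d - 1) / 2`. -/
noncomputable def adsCoeff (δ μ : ℝ) (n : ℕ) : ℝ :=
  Gamma (δ + μ + 2 * n) /
    (2 * π ^ δ * Gamma (μ + 1 + n) * (n.factorial : ℝ) * 2 ^ (δ + μ + 2 * n))

/-- The Källén–Lehmann weight as a function of `δ = (d - 1) / 2`. -/
noncomputable def klRho (δ : ℝ) (k : ℕ) (l v : ℝ) : ℝ :=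
  (2 * δ + 4 * k + 2 * l + 2 * v) * Gamma (1 + 2 * k + l + v) /
      (4 * π ^ δ * Gamma δ * Gamma (2 * δ + 2 * k + l + v)) *
    (Gamma (δ + k) * Gamma (δ + l + k) * Gamma (δ + v + k) * Gamma (δ + l + v + k) /
      (Gamma (1 + k) * Gamma (1 + l + k) * Gamma (1 + v + k) * Gamma (1 + l + v + k)))

lemma adsCoeff_pos {δ μ : ℝ} (hσ : 0 < δ + μ) (hμ : 0 < μ) (n : ℕ) : 0 < adsCoeff δ μ n := by
  have h1 : 0 < Gamma (δ + μ + 2 * n) := Gamma_pos_of_pos (by positivity)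
  have h2 : 0 < Gamma (μ + 1 + n) := Gamma_pos_of_pos (by positivity)
  have := Nat.factorial_pos n
  unfold adsCoeff
  positivity

lemma adsCoeff_succ {δ μ : ℝ} (hσ : 0 < δ + μ) (hμ : 0 < μ) (n : ℕ) :
    adsCoeff δ μ (n + 1) * (4 * (μ + 1 + n) * (n + 1)) =
      (δ + μ + 2 * n) * (δ + μ + 2 * n + 1) * adsCoeff δ μ n := by
  have h2 : 0 < Gamma (μ + 1 + n) := Gamma_pos_of_pos (by positivity)
  have e1 : Gamma (δ + μ + 2 * (n + 1 : ℕ)) =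
      (δ + μ + 2 * n + 1) * ((δ + μ + 2 * n) * Gamma (δ + μ + 2 * n)) := by
    rw [← Gamma_add_one (by positivity), ← Gamma_add_one (by positivity)]
    congr 1; push_cast; ring
  have e2 : Gamma (μ + 1 + (n + 1 : ℕ)) = (μ + 1 + n) * Gamma (μ + 1 + n) := by
    rw [← Gamma_add_one (by positivity)]
    congr 1; push_cast; ring
  have e3 : (2 : ℝ) ^ (δ + μ + 2 * (n + 1 : ℕ)) = 4 * 2 ^ (δ + μ + 2 * n) := by
    rw [show δ + μ + 2 * ((n + 1 : ℕ) : ℝ) = δ + μ + 2 * n + 2 by push_cast; ring,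
      rpow_add two_pos]
    norm_num; ring
  have hπ : 0 < π ^ δ := rpow_pos_of_pos pi_pos _
  have h4 : (0 : ℝ) < 2 ^ (δ + μ + 2 * n) := by positivity
  have h5 : (0 : ℝ) < μ + 1 + n := by positivity
  unfold adsCoeff
  rw [e1, e2, e3, Nat.factorial_succ]
  push_cast
  field_simp

lemma adsCoeff_add_two {δ μ : ℝ} (hμ : 0 < μ) (n : ℕ) :
    adsCoeff δ (μ + 2) n * (μ + 2 + n) = adsCoeff δ μ (n + 1) * (n + 1) := by
  have h2 : 0 < Gamma (μ + 2 + n) := Gamma_pos_of_pos (by positivity)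
  have e2 : Gamma (μ + 2 + 1 + n) = (μ + 2 + n) * Gamma (μ + 2 + n) := by
    rw [← Gamma_add_one (by positivity)]
    congr 1; ring
  have hπ : 0 < π ^ δ := rpow_pos_of_pos pi_pos _
  have h4 : (0 : ℝ) < 2 ^ (δ + (μ + 2) + 2 * n) := by positivity
  have h5 : (0 : ℝ) < μ + 2 + n := by positivity
  unfold adsCoeff
  rw [e2, Nat.factorial_succ]
  push_cast
  rw [show δ + μ + 2 * ((n : ℝ) + 1) = δ + (μ + 2) + 2 * n by ring,
    show μ + 1 + ((n : ℝ) + 1) = μ + 2 + n by ring]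
  field_simp

lemma klRho_pos {δ l v : ℝ} (hδ : 0 < δ) (hl : 0 < l) (hv : 0 < v) (k : ℕ) :
    0 < klRho δ k l v := by
  have hG : ∀ x : ℝ, 0 < x → 0 < Gamma x := fun x hx => Gamma_pos_of_pos hx
  have hπ : 0 < π ^ δ := rpow_pos_of_pos pi_pos _
  have h1 := hG (1 + 2 * k + l + v) (by positivity)
  have h2 := hG (2 * δ + 2 * k + l + v) (by positivity)
  have h3 := hG (δ + k) (by positivity)
  have h4 := hG (δ + l + k) (by positivity)
  have h5 := hG (δ + v + k) (by positivity)
  have h6 := hG (δ + l + v + k) (by positivity)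
  have h7 := hG (1 + k) (by positivity)
  have h8 := hG (1 + l + k) (by positivity)
  have h9 := hG (1 + v + k) (by positivity)
  have h10 := hG (1 + l + v + k) (by positivity)
  have h11 := hG δ hδ
  unfold klRho
  positivity

lemma klRho_succ {δ l v : ℝ} (hδ : 0 < δ) (hl : 0 < l) (hv : 0 < v) (k : ℕ) :
    klRho δ (k + 1) l v * ((2 * δ + 4 * k + 2 * l + 2 * v) * ((2 * δ + 2 * k + l + v) *
        (2 * δ + 2 * k + l + v + 1) * (1 + k) * (1 + l + k) * (1 + v + k) * (1 + l + v + k))) =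
      klRho δ k l v * ((2 * δ + 4 * (k + 1) + 2 * l + 2 * v) * ((1 + 2 * k + l + v) *
        (1 + 2 * k + l + v + 1) * ((δ + k) * (δ + l + k) * (δ + v + k) * (δ + l + v + k)))) := by
  have hG : ∀ x y : ℝ, 0 < x → y = x + 1 → Gamma y = x * Gamma x := by
    rintro x y hx rfl
    exact Gamma_add_one hx.ne'
  have hP : ∀ x : ℝ, 0 < x → 0 < Gamma x := fun x hx => Gamma_pos_of_pos hx
  have hπ : 0 < π ^ δ := rpow_pos_of_pos pi_pos _
  have h2 := hP (2 * δ + 2 * k + l + v) (by positivity)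
  have h7 := hP (1 + k) (by positivity)
  have h8 := hP (1 + l + k) (by positivity)
  have h9 := hP (1 + v + k) (by positivity)
  have h10 := hP (1 + l + v + k) (by positivity)
  have h11 := hP δ hδ
  have i2 : (0 : ℝ) < 2 * δ + 2 * k + l + v := by positivity
  have i3 : (0 : ℝ) < 2 * δ + 2 * k + l + v + 1 := by positivity
  have i4 : (0 : ℝ) < 1 + l + k := by positivity
  have i5 : (0 : ℝ) < 1 + v + k := by positivity
  have i6 : (0 : ℝ) < 1 + l + v + k := by positivity
  have i7 : (0 : ℝ) < 1 + k := by positivity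
  unfold klRho
  push_cast
  rw [hG (1 + 2 * k + l + v + 1) (1 + 2 * ((k : ℝ) + 1) + l + v) (by positivity) (by ring),
    hG (1 + 2 * k + l + v) (1 + 2 * (k : ℝ) + l + v + 1) (by positivity) (by ring),
    hG (2 * δ + 2 * k + l + v + 1) (2 * δ + 2 * ((k : ℝ) + 1) + l + v) (by positivity) (by ring),
    hG (2 * δ + 2 * k + l + v) (2 * δ + 2 * (k : ℝ) + l + v + 1) (by positivity) (by ring),
    hG (δ + k) (δ + ((k : ℝ) + 1)) (by positivity) (by ring),
    hG (δ + l + k) (δ + l + ((k : ℝ) + 1)) (by positivity) (by ring),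
    hG (δ + v + k) (δ + v + ((k : ℝ) + 1)) (by positivity) (by ring),
    hG (δ + l + v + k) (δ + l + v + ((k : ℝ) + 1)) (by positivity) (by ring),
    hG (1 + k) (1 + ((k : ℝ) + 1)) (by positivity) (by ring),
    hG (1 + l + k) (1 + l + ((k : ℝ) + 1)) (by positivity) (by ring),
    hG (1 + v + k) (1 + v + ((k : ℝ) + 1)) (by positivity) (by ring),
    hG (1 + l + v + k) (1 + l + v + ((k : ℝ) + 1)) (by positivity) (by ring)]
  generalize Gamma (1 + 2 * k + l + v) = g1 at *
  generalize Gamma (2 * δ + 2 * k + l + v) = g2 at *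
  generalize Gamma (δ + k) = g3 at *
  generalize Gamma (δ + l + k) = g4 at *
  generalize Gamma (δ + v + k) = g5 at *
  generalize Gamma (δ + l + v + k) = g6 at *
  generalize Gamma (1 + k) = g7 at *
  generalize Gamma (1 + l + k) = g8 at *
  generalize Gamma (1 + v + k) = g9 at *
  generalize Gamma (1 + l + v + k) = g10 at *
  field_simp

/-- The contribution of the `k`-th term of the Källén–Lehmann expansion of a product of two
propagators to the coefficient of `u ^ (-(2 δ + l + v + 2 N))`. -/
noncomputable def klTerm (δ l v : ℝ) (k N : ℕ) : ℝ :=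
  if k ≤ N then klRho δ k l v * adsCoeff δ (δ + l + v + 2 * k) (N - k) else 0

lemma klTerm_add (δ l v : ℝ) (k n : ℕ) :
    klTerm δ l v k (k + n) = klRho δ k l v * adsCoeff δ (δ + l + v + 2 * k) n := by
  simp [klTerm]

lemma klTerm_of_lt (δ l v : ℝ) {k N : ℕ} (h : N < k) : klTerm δ l v k N = 0 := by
  simp [klTerm, h]

lemma klTerm_succ_right {δ l v : ℝ} (hδ : 0 < δ) (hl : 0 < l) (hv : 0 < v) (k N : ℕ) :
    klTerm δ l v k (N + 1) * (4 * (δ + l + v + k + N + 1) * (N + 1 - k)) =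
      (2 * δ + l + v + 2 * N) * (2 * δ + l + v + 2 * N + 1) * klTerm δ l v k N := by
  rcases lt_trichotomy k (N + 1) with h | rfl | h
  · obtain ⟨n, rfl⟩ := Nat.exists_eq_add_of_le (Nat.lt_succ_iff.mp h)
    rw [add_assoc, klTerm_add, klTerm_add]
    have := adsCoeff_succ (δ := δ) (μ := δ + l + v + 2 * k) (by positivity) (by positivity) n
    push_cast
    linear_combination klRho δ k l v * this
  · rw [klTerm_of_lt _ _ _ (Nat.lt_succ_self N)]
    push_cast; ring
  · rw [klTerm_of_lt _ _ _ h, klTerm_of_lt _ _ _ ((Nat.lt_succ_self N).trans h)]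
    ring

lemma klTerm_succ_left {δ l v : ℝ} (hδ : 0 < δ) (hl : 0 < l) (hv : 0 < v) (k N : ℕ) (h : k ≤ N) :
    klTerm δ l v (k + 1) N * (δ + l + v + k + 1 + N) *
        ((2 * δ + 4 * k + 2 * l + 2 * v) * ((2 * δ + 2 * k + l + v) *
        (2 * δ + 2 * k + l + v + 1) * (1 + k) * (1 + l + k) * (1 + v + k) * (1 + l + v + k))) =
      klTerm δ l v k N * (N - k) * ((2 * δ + 4 * (k + 1) + 2 * l + 2 * v) * ((1 + 2 * k + l + v) *
        (1 + 2 * k + l + v + 1) * ((δ + k) * (δ + l + k) * (δ + v + k) * (δ + l + v + k)))) := by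
  have h1 := klRho_succ hδ hl hv k
  generalize (2 * δ + 4 * k + 2 * l + 2 * v) * ((2 * δ + 2 * k + l + v) *
        (2 * δ + 2 * k + l + v + 1) * (1 + k) * (1 + l + k) * (1 + v + k) *
        (1 + l + v + k)) = X at *
  generalize (2 * δ + 4 * ((k : ℝ) + 1) + 2 * l + 2 * v) * ((1 + 2 * k + l + v) *
        (1 + 2 * k + l + v + 1) * ((δ + k) * (δ + l + k) * (δ + v + k) * (δ + l + v + k))) = Y at *
  rcases h.eq_or_lt with rfl | h
  · rw [klTerm_of_lt _ _ _ (Nat.lt_succ_self k)]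
    ring
  · obtain ⟨n, rfl⟩ := Nat.exists_eq_add_of_le (Nat.succ_le_of_lt h)
    rw [klTerm_add, show k.succ + n = k + (n + 1) by omega, klTerm_add]
    have h2 := adsCoeff_add_two (δ := δ) (μ := δ + l + v + 2 * k) (by positivity) n
    rw [show δ + l + v + 2 * ((k + 1 : ℕ) : ℝ) = δ + l + v + 2 * k + 2 by push_cast; ring]
    push_cast
    linear_combination
      (adsCoeff δ (δ + l + v + 2 * k + 2) n * (δ + l + v + 2 * k + 2 + n)) * h1 +
      klRho δ k l v * Y * h2

/-- The coefficient relating neighbouring powers in the fourth-order equation satisfied by a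
product of two propagators, evaluated on the `k`-th Källén–Lehmann term. -/
def klSymbol (δ l v y e : ℝ) : ℝ := (4 * δ * e + y) * y - 4 * ((l ^ 2 - δ ^ 2) * (v ^ 2 - δ ^ 2))

lemma klSymbol_factor_zero (δ l v k : ℝ) :
    klSymbol δ l v ((δ + l + v + 2 * k) ^ 2 + δ ^ 2 - l ^ 2 - v ^ 2) (-(l + v + 2 * k)) =
      16 * (k * (k + l) * (k + v) * (k + (l + v))) := by
  unfold klSymbol; ring

lemma klSymbol_factor_shift (δ l v k : ℝ) :
    klSymbol δ l v ((δ + l + v + 2 * k) ^ 2 + δ ^ 2 - l ^ 2 - v ^ 2) (2 * δ + l + v + 2 * k) =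
      16 * ((δ + k) * (δ + l + k) * (δ + v + k) * (δ + l + v + k)) := by
  unfold klSymbol; ring

lemma klSymbol_telescope (δ l v y μ n : ℝ) :
    μ * (klSymbol δ l v y (δ - (μ + 2 * n)) * ((μ + δ + 2 * n - 1) * (μ + δ + 2 * n - 2)) -
        4 * (μ + n) * n * klSymbol δ l v y (3 - (μ + δ + 2 * n))) =
      (μ + δ - 1) * (μ + δ - 2) * klSymbol δ l v y (δ - μ) * (μ + n) -
        (μ - δ + 1) * (μ - δ + 2) * klSymbol δ l v y (δ + μ) * n := by
  unfold klSymbol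
  generalize (l ^ 2 - δ ^ 2) * (v ^ 2 - δ ^ 2) = c
  ring

lemma klTerm_telescope {δ l v : ℝ} (hδ : 0 < δ) (hl : 0 < l) (hv : 0 < v) (N : ℕ) :
    ∑ k ∈ Finset.range (N + 2),
      (klTerm δ l v k (N + 1) * klSymbol δ l v
          ((δ + l + v + 2 * k) ^ 2 + δ ^ 2 - l ^ 2 - v ^ 2) (-(l + v + 2 * (N + 1))) -
        klTerm δ l v k N * klSymbol δ l v
          ((δ + l + v + 2 * k) ^ 2 + δ ^ 2 - l ^ 2 - v ^ 2)
          (3 - (2 * δ + l + v + 2 * (N + 1)))) = 0 := by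
  have hs : (0 : ℝ) < (2 * δ + l + v + 2 * N) * (2 * δ + l + v + 2 * N + 1) := by positivity
  set H : ℕ → ℝ := fun k => -16 * ((2 * δ + l + v + 2 * k - 1) * (2 * δ + l + v + 2 * k - 2) *
    (k * (k + l) * (k + v) * (k + (l + v)))) / (δ + l + v + 2 * k) * (δ + l + v + k + (N + 1)) *
    klTerm δ l v k (N + 1) with hH
  have key : ∀ k ∈ Finset.range (N + 2), (klTerm δ l v k (N + 1) * klSymbol δ l v
          ((δ + l + v + 2 * k) ^ 2 + δ ^ 2 - l ^ 2 - v ^ 2) (-(l + v + 2 * (N + 1))) -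
        klTerm δ l v k N * klSymbol δ l v
          ((δ + l + v + 2 * k) ^ 2 + δ ^ 2 - l ^ 2 - v ^ 2)
          (3 - (2 * δ + l + v + 2 * (N + 1)))) =
      (H (k + 1) - H k) / ((2 * δ + l + v + 2 * N) * (2 * δ + l + v + 2 * N + 1)) := by
    intro k hk
    rw [eq_div_iff hs.ne']
    have h1 := klTerm_succ_right hδ hl hv k N
    have h2 := klTerm_succ_left hδ hl hv k (N + 1) (by simp at hk; omega)
    have ha : (0 : ℝ) < δ + l + v + 2 * k := by positivity
    have hb : (0 : ℝ) < δ + l + v + 2 * k + 2 := by positivity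
    have f0 := klSymbol_factor_zero δ l v k
    have f1 := klSymbol_factor_shift δ l v k
    have ht := klSymbol_telescope δ l v ((δ + l + v + 2 * k) ^ 2 + δ ^ 2 - l ^ 2 - v ^ 2)
      (δ + l + v + 2 * k) (N + 1 - k)
    have e1 : H (k + 1) = -(klTerm δ l v k (N + 1) * (N + 1 - k) * ((l + v + 2 * k + 1) *
        (l + v + 2 * k + 2)) * (16 * ((δ + k) * (δ + l + k) * (δ + v + k) * (δ + l + v + k)))) /
        (δ + l + v + 2 * k) := by
      rw [eq_div_iff ha.ne']
      rw [show H (k + 1) = _ from congrFun hH (k + 1)]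
      push_cast at h2 ⊢
      rw [show δ + l + v + 2 * ((k : ℝ) + 1) = δ + l + v + 2 * k + 2 by ring,
        show 2 * δ + l + v + 2 * ((k : ℝ) + 1) - 1 = 2 * δ + 2 * k + l + v + 1 by ring,
        show 2 * δ + l + v + 2 * ((k : ℝ) + 1) - 2 = 2 * δ + 2 * k + l + v by ring,
        show (k : ℝ) + 1 + l = 1 + l + k by ring, show (k : ℝ) + 1 + v = 1 + v + k by ring,
        show (k : ℝ) + 1 + (l + v) = 1 + l + v + k by ring, show (k : ℝ) + 1 = 1 + k by ring,
        show l + v + 2 * (k : ℝ) + 2 = 1 + 2 * k + l + v + 1 by ring,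
        show l + v + 2 * (k : ℝ) + 1 = 1 + 2 * k + l + v by ring,
        show δ + l + v + (1 + (k : ℝ)) + (N + 1) = δ + l + v + k + 1 + (N + 1) by ring,
        div_mul_eq_mul_div, div_mul_eq_mul_div, div_mul_eq_mul_div, div_eq_iff hb.ne']
      rw [show 2 * δ + 4 * (k : ℝ) + 2 * l + 2 * v = 2 * (δ + l + v + 2 * k) by ring,
        show 2 * δ + 4 * ((k : ℝ) + 1) + 2 * l + 2 * v = 2 * (δ + l + v + 2 * k + 2) by ring] at h2
      generalize δ + l + v + 2 * (k : ℝ) + 2 = x1 at *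
      generalize δ + l + v + 2 * (k : ℝ) = x2 at *
      generalize (2 * δ + 2 * (k : ℝ) + l + v + 1) = x3 at *
      generalize (2 * δ + 2 * (k : ℝ) + l + v) = x4 at *
      generalize 1 + l + v + (k : ℝ) = x5 at *
      generalize 1 + v + (k : ℝ) = x6 at *
      generalize 1 + l + (k : ℝ) = x7 at *
      generalize 1 + (k : ℝ) = x8 at *
      generalize 1 + 2 * (k : ℝ) + l + v + 1 = x9 at *
      generalize 1 + 2 * (k : ℝ) + l + v = x10 at *
      generalize (δ + k) * (δ + l + k) * (δ + v + k) * (δ + l + v + k) = x11 at *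
      generalize δ + l + v + k + 1 + ((N : ℝ) + 1) = x12 at *
      linear_combination -8 * h2
    have e0 : H k = _ := congrFun hH k
    rw [e1, e0, ← f1]
    rw [show (-16 : ℝ) * ((2 * δ + l + v + 2 * k - 1) * (2 * δ + l + v + 2 * k - 2) *
      (k * (k + l) * (k + v) * (k + (l + v)))) = -((2 * δ + l + v + 2 * k - 1) *
      (2 * δ + l + v + 2 * k - 2) * (16 * (k * (k + l) * (k + v) * (k + (l + v))))) by ring, ← f0]
    rw [show δ - (δ + l + v + 2 * k + 2 * ((N : ℝ) + 1 - k)) = -(l + v + 2 * (N + 1)) by ring,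
      show 3 - (δ + l + v + 2 * (k : ℝ) + δ + 2 * ((N : ℝ) + 1 - k)) =
        3 - (2 * δ + l + v + 2 * (N + 1)) by ring,
      show δ - (δ + l + v + 2 * (k : ℝ)) = -(l + v + 2 * k) by ring,
      show δ + (δ + l + v + 2 * (k : ℝ)) = 2 * δ + l + v + 2 * k by ring] at ht
    generalize (δ + l + v + 2 * (k : ℝ)) ^ 2 + δ ^ 2 - l ^ 2 - v ^ 2 = y at ht ⊢
    generalize klSymbol δ l v y (-(l + v + 2 * (N + 1))) = s1 at ht ⊢
    generalize klSymbol δ l v y (3 - (2 * δ + l + v + 2 * (N + 1))) = s2 at ht ⊢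
    generalize klSymbol δ l v y (-(l + v + 2 * k)) = s3 at ht ⊢
    generalize klSymbol δ l v y (2 * δ + l + v + 2 * k) = s4 at ht ⊢
    generalize klTerm δ l v k (N + 1) = t1 at *
    generalize klTerm δ l v k N = t0 at *
    rw [div_mul_eq_mul_div, div_mul_eq_mul_div, ← sub_div, eq_div_iff ha.ne']
    linear_combination t1 * ht + (δ + l + v + 2 * k) * s2 * h1
  rw [Finset.sum_congr rfl key, ← Finset.sum_div, Finset.sum_range_sub]
  simp [hH, klTerm_of_lt]

/-- The action of `u d/du` on `u ^ (-σ) f (u ^ (-2))`, written on the power series `f`. -/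
noncomputable def twistedEuler (σ : ℝ) (f : PowerSeries ℝ) : PowerSeries ℝ :=
  PowerSeries.mk fun n => -(σ + 2 * n) * PowerSeries.coeff n f

lemma coeff_twistedEuler (σ : ℝ) (f : PowerSeries ℝ) (n : ℕ) :
    PowerSeries.coeff n (twistedEuler σ f) = -(σ + 2 * n) * PowerSeries.coeff n f :=
  PowerSeries.coeff_mk _ _

lemma twistedEuler_mul (σ τ : ℝ) (f g : PowerSeries ℝ) :
    twistedEuler (σ + τ) (f * g) = twistedEuler σ f * g + f * twistedEuler τ g := by
  ext n
  simp only [coeff_twistedEuler, PowerSeries.coeff_mul, map_add, ← Finset.sum_add_distrib,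
    Finset.mul_sum]
  refine Finset.sum_congr rfl fun p hp => ?_
  rw [← Finset.HasAntidiagonal.mem_antidiagonal.mp hp]
  push_cast
  ring

lemma twistedEuler_add (σ : ℝ) (f g : PowerSeries ℝ) :
    twistedEuler σ (f + g) = twistedEuler σ f + twistedEuler σ g := by
  ext n; simp only [coeff_twistedEuler, map_add]; ring

lemma twistedEuler_C_mul (σ c : ℝ) (f : PowerSeries ℝ) :
    twistedEuler σ (PowerSeries.C c * f) = PowerSeries.C c * twistedEuler σ f := by
  ext n; simp only [coeff_twistedEuler, PowerSeries.coeff_C_mul]; ring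

lemma twistedEuler_one_sub_X_mul (σ : ℝ) (f : PowerSeries ℝ) :
    twistedEuler σ ((1 - PowerSeries.X) * f) =
      (1 - PowerSeries.X) * twistedEuler σ f + 2 * PowerSeries.X * f := by
  have h2 : (2 : PowerSeries ℝ) = PowerSeries.C 2 := (map_ofNat PowerSeries.C 2).symm
  ext n
  rw [h2]
  rcases n with _ | n
  · simp only [coeff_twistedEuler, sub_mul, one_mul, map_sub, map_add,
      PowerSeries.coeff_zero_X_mul, mul_assoc, PowerSeries.coeff_C_mul]
    ring
  · simp only [coeff_twistedEuler, sub_mul, one_mul, map_sub, map_add,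
      PowerSeries.coeff_succ_X_mul, mul_assoc, PowerSeries.coeff_C_mul]
    push_cast; ring

lemma coeff_zero_secondOrder (σ c c' : ℝ) (f : PowerSeries ℝ) :
    PowerSeries.coeff 0 ((1 - PowerSeries.X) * (twistedEuler σ (twistedEuler σ f) -
      twistedEuler σ f) + PowerSeries.C c * twistedEuler σ f + PowerSeries.C c' * f) =
    (σ ^ 2 + σ - c * σ + c') * PowerSeries.coeff 0 f := by
  simp only [coeff_twistedEuler, sub_mul, one_mul, map_sub, map_add,
    PowerSeries.coeff_zero_X_mul, PowerSeries.coeff_C_mul]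
  push_cast
  ring

lemma coeff_succ_secondOrder (σ c c' : ℝ) (f : PowerSeries ℝ) (n : ℕ) :
    PowerSeries.coeff (n + 1) ((1 - PowerSeries.X) * (twistedEuler σ (twistedEuler σ f) -
      twistedEuler σ f) + PowerSeries.C c * twistedEuler σ f + PowerSeries.C c' * f) =
    ((σ + 2 * (n + 1 : ℕ)) ^ 2 + (1 - c) * (σ + 2 * (n + 1 : ℕ)) + c') *
      PowerSeries.coeff (n + 1) f - (σ + 2 * n) * (σ + 2 * n + 1) * PowerSeries.coeff n f := by
  simp only [coeff_twistedEuler, sub_mul, one_mul, map_sub, map_add,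
    PowerSeries.coeff_succ_X_mul, PowerSeries.coeff_C_mul]
  push_cast
  ring

lemma adsCoeff_ode {δ μ : ℝ} (hσ : 0 < δ + μ) (hμ : 0 < μ) :
    (1 - PowerSeries.X) * (twistedEuler (δ + μ) (twistedEuler (δ + μ)
        (PowerSeries.mk (adsCoeff δ μ))) - twistedEuler (δ + μ) (PowerSeries.mk (adsCoeff δ μ))) +
      PowerSeries.C (2 * δ + 1) * twistedEuler (δ + μ) (PowerSeries.mk (adsCoeff δ μ)) +
      PowerSeries.C (δ ^ 2 - μ ^ 2) * PowerSeries.mk (adsCoeff δ μ) = 0 := by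
  ext n
  rcases n with _ | n
  · rw [coeff_zero_secondOrder, map_zero]
    ring
  · rw [coeff_succ_secondOrder, map_zero, PowerSeries.coeff_mk, PowerSeries.coeff_mk]
    push_cast
    linear_combination adsCoeff_succ hσ hμ n

/-- Uniqueness for the recursion equivalent to the fourth-order equation satisfied by a product
of two propagators. -/
lemma eq_of_product_recursion {p r w p' r' w' α g h : ℕ → ℝ} {b c : ℝ}
    (hne : ∀ n, h (n + 1) * g (n + 1) - 4 * c ≠ 0)
    (h0 : p 0 = p' 0) (hr0 : r 0 = r' 0) (hw0 : w 0 = w' 0)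
    (h1 : ∀ n, 2 * r (n + 1) = g (n + 1) * p (n + 1) - α n * p n)
    (h2 : ∀ n, w (n + 1) = h (n + 1) * r (n + 1) - α n * r n)
    (h3 : ∀ n, w (n + 1) = w n - b * r n + 2 * c * (p (n + 1) - p n))
    (h1' : ∀ n, 2 * r' (n + 1) = g (n + 1) * p' (n + 1) - α n * p' n)
    (h2' : ∀ n, w' (n + 1) = h (n + 1) * r' (n + 1) - α n * r' n)
    (h3' : ∀ n, w' (n + 1) = w' n - b * r' n + 2 * c * (p' (n + 1) - p' n)) (n : ℕ) :
    p n = p' n := by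
  suffices p n = p' n ∧ r n = r' n ∧ w n = w' n from this.1
  induction n with
  | zero => exact ⟨h0, hr0, hw0⟩
  | succ n ih =>
    obtain ⟨i1, i2, i3⟩ := ih
    have e1 := h1 n
    have e2 := h2 n
    have e3 := h3 n
    have e1' := h1' n
    have e2' := h2' n
    have e3' := h3' n
    rw [i1] at e1 e3
    rw [i2] at e2 e3
    rw [i3] at e3
    have hp : p (n + 1) = p' (n + 1) := by
      have : (h (n + 1) * g (n + 1) - 4 * c) * (p (n + 1) - p' (n + 1)) = 0 := by
        linear_combination -h (n + 1) * (e1 - e1') + 2 * (e3 - e3') - 2 * (e2 - e2')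
      simpa [hne n, sub_eq_zero] using this
    have hr : r (n + 1) = r' (n + 1) := by
      rw [hp] at e1
      linarith
    refine ⟨hp, hr, ?_⟩
    rw [e2, e2', hr]

/-- The system of recursions satisfied by the coefficients of a product of two propagators. -/
lemma product_recursion {δ l v : ℝ} (hδ : 0 < δ) (hl : 0 < l) (hv : 0 < v) :
    ∃ r w : ℕ → ℝ, ∃ p : ℕ → ℝ,
      (∀ n, p n = ∑ ij ∈ Finset.HasAntidiagonal.antidiagonal n,
        adsCoeff δ l ij.1 * adsCoeff δ v ij.2) ∧
      2 * r 0 = ((2 * δ + l + v) * (l + v) - (l ^ 2 + v ^ 2 - 2 * δ ^ 2)) * p 0 ∧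
      w 0 = ((l + v) * (l + v - 2 * δ) - (l ^ 2 + v ^ 2 - 2 * δ ^ 2)) * r 0 ∧
      (∀ n : ℕ, 2 * r (n + 1) = ((2 * δ + l + v + 2 * (n + 1 : ℕ)) * (l + v + 2 * (n + 1 : ℕ)) -
          (l ^ 2 + v ^ 2 - 2 * δ ^ 2)) * p (n + 1) -
          (2 * δ + l + v + 2 * n) * (2 * δ + l + v + 2 * n + 1) * p n) ∧
      (∀ n : ℕ, w (n + 1) = ((l + v + 2 * (n + 1 : ℕ)) * (l + v + 2 * (n + 1 : ℕ) - 2 * δ) -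
          (l ^ 2 + v ^ 2 - 2 * δ ^ 2)) * r (n + 1) -
          (2 * δ + l + v + 2 * n) * (2 * δ + l + v + 2 * n + 1) * r n) ∧
      (∀ n : ℕ, w (n + 1) = w n - 4 * δ * (2 * δ - 1) * r n +
          2 * ((l ^ 2 - δ ^ 2) * (v ^ 2 - δ ^ 2)) * (p (n + 1) - p n)) := by
  set P := PowerSeries.mk (adsCoeff δ l) with hP
  set Q := PowerSeries.mk (adsCoeff δ v) with hQ
  have hp := adsCoeff_ode (δ := δ) (μ := l) (by positivity) hl
  have hq := adsCoeff_ode (δ := δ) (μ := v) (by positivity) hv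
  rw [← hP] at hp
  rw [← hQ] at hq
  set P1 := twistedEuler (δ + l) P with hP1
  set P2 := twistedEuler (δ + l) P1 with hP2
  set Q1 := twistedEuler (δ + v) Q with hQ1
  set Q2 := twistedEuler (δ + v) Q1 with hQ2
  set D := twistedEuler (δ + l + (δ + v)) with hD
  set x : PowerSeries ℝ := PowerSeries.X with hx
  set A : PowerSeries ℝ := PowerSeries.C (l ^ 2 - δ ^ 2) with hA
  set B : PowerSeries ℝ := PowerSeries.C (v ^ 2 - δ ^ 2) with hB
  set t : PowerSeries ℝ := PowerSeries.C δ with ht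
  have ht1 : PowerSeries.C (2 * δ + 1) = 2 * t + 1 := by
    rw [ht, map_add, map_mul, map_one, map_ofNat PowerSeries.C 2]
  have hA' : PowerSeries.C (δ ^ 2 - l ^ 2) = -A := by rw [hA, ← map_neg, neg_sub]
  have hB' : PowerSeries.C (δ ^ 2 - v ^ 2) = -B := by rw [hB, ← map_neg, neg_sub]
  have hc : PowerSeries.C (-4 * δ) = -4 * t := by
    rw [ht, map_mul, map_neg, map_ofNat PowerSeries.C 4]
  rw [ht1, hA'] at hp
  rw [ht1, hB'] at hq
  set R := (1 - x) * (P1 * Q1) with hR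
  have dPQ : D (P * Q) = P1 * Q + P * Q1 := twistedEuler_mul _ _ _ _
  have dPQ1 : D (P * Q1) = P1 * Q1 + P * Q2 := twistedEuler_mul _ _ _ _
  have dP1Q : D (P1 * Q) = P2 * Q + P1 * Q1 := twistedEuler_mul _ _ _ _
  have dP1Q1 : D (P1 * Q1) = P2 * Q1 + P1 * Q2 := twistedEuler_mul _ _ _ _
  have dR : D R = A * (P * Q1) + (B * (P1 * Q) + PowerSeries.C (-4 * δ) * (P1 * Q1)) := by
    rw [hR, hD, twistedEuler_one_sub_X_mul, ← hD, dP1Q1, hc]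
    linear_combination Q1 * hp + P1 * hq
  have ddR : D (D R) = A * (P1 * Q1 + P * Q2) + (B * (P2 * Q + P1 * Q1) +
      -4 * t * (P2 * Q1 + P1 * Q2)) := by
    rw [dR, hD, twistedEuler_add, twistedEuler_add, hA, hB, twistedEuler_C_mul,
      twistedEuler_C_mul, twistedEuler_C_mul, ← hD, dPQ1, dP1Q, dP1Q1, hc]
  have ddPQ : D (D (P * Q)) = P2 * Q + P1 * Q1 + (P1 * Q1 + P * Q2) := by
    rw [dPQ, hD, twistedEuler_add, ← hD, dP1Q, dPQ1]
  have hAB : PowerSeries.C (2 * δ ^ 2 - l ^ 2 - v ^ 2) = -A - B := by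
    rw [hA, hB, ← map_neg, ← map_sub]
    ring_nf
  have e1 : PowerSeries.C 2 * R = (1 - x) * (D (D (P * Q)) - D (P * Q)) +
      PowerSeries.C (2 * δ + 1) * D (P * Q) +
      PowerSeries.C (2 * δ ^ 2 - l ^ 2 - v ^ 2) * (P * Q) := by
    rw [ddPQ, dPQ, ht1, hAB, map_ofNat PowerSeries.C 2]
    linear_combination -Q * hp - P * hq
  set W := (1 - x) * (D (D R) - D R) + PowerSeries.C (6 * δ + 1) * D R +
    PowerSeries.C (10 * δ ^ 2 - l ^ 2 - v ^ 2) * R with hW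
  have e3 : (1 - x) * W + x * (PowerSeries.C (4 * δ * (2 * δ - 1)) * R) =
      (1 - x) * (PowerSeries.C (2 * ((l ^ 2 - δ ^ 2) * (v ^ 2 - δ ^ 2))) * (P * Q)) := by
    have h6 : PowerSeries.C (6 * δ + 1) = 6 * t + 1 := by
      rw [ht, map_add, map_mul, map_one, map_ofNat PowerSeries.C 6]
    have h8 : PowerSeries.C (10 * δ ^ 2 - l ^ 2 - v ^ 2) = 8 * t ^ 2 - A - B := by
      rw [ht, hA, hB, ← map_ofNat PowerSeries.C 8, ← map_pow, ← map_mul, ← map_sub, ← map_sub]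
      ring_nf
    have h4 : PowerSeries.C (4 * δ * (2 * δ - 1)) = 4 * t * (2 * t - 1) := by
      rw [ht, map_mul, map_mul, map_sub, map_mul, map_one, map_ofNat PowerSeries.C 4,
        map_ofNat PowerSeries.C 2]
    have h2 : PowerSeries.C (2 * ((l ^ 2 - δ ^ 2) * (v ^ 2 - δ ^ 2))) = 2 * A * B := by
      rw [hA, hB, map_mul, map_mul, map_ofNat PowerSeries.C 2, mul_assoc]
    rw [hW, ddR, dR, hR, hc, h6, h8, h4, h2]
    linear_combination (1 - x) * (B * Q - 4 * t * Q1) * hp + (1 - x) * (A * P - 4 * t * P1) * hq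
  refine ⟨fun n => PowerSeries.coeff n R, fun n => PowerSeries.coeff n W,
    fun n => PowerSeries.coeff n (P * Q), fun n => ?_, ?_, ?_, fun n => ?_, fun n => ?_,
    fun n => ?_⟩
  · simp only [hP, hQ, PowerSeries.coeff_mul, PowerSeries.coeff_mk]
  · have h := congrArg (PowerSeries.coeff 0) e1
    rw [hD, hx, coeff_zero_secondOrder, PowerSeries.coeff_C_mul] at h
    linear_combination h
  · beta_reduce
    rw [hW, hD, hx, coeff_zero_secondOrder]
    ring
  · have h := congrArg (PowerSeries.coeff (n + 1)) e1
    rw [hD, hx, coeff_succ_secondOrder, PowerSeries.coeff_C_mul] at h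
    linear_combination h
  · beta_reduce
    rw [hW, hD, hx, coeff_succ_secondOrder]
    ring
  · have h := congrArg (PowerSeries.coeff (n + 1)) e3
    simp only [hx, sub_mul, one_mul, map_add, map_sub, PowerSeries.coeff_succ_X_mul,
      PowerSeries.coeff_C_mul] at h
    linear_combination h

lemma klTerm_zero_zero {δ l v : ℝ} (hδ : 0 < δ) (hl : 0 < l) (hv : 0 < v) :
    klTerm δ l v 0 0 = adsCoeff δ l 0 * adsCoeff δ v 0 := by
  have e : Gamma (δ + l + v + 1) = (δ + l + v) * Gamma (δ + l + v) :=
    Gamma_add_one (by positivity)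
  have h1 : Gamma (1 + l + v) ≠ 0 := (Gamma_pos_of_pos (by positivity)).ne'
  have h2 : Gamma (2 * δ + l + v) ≠ 0 := (Gamma_pos_of_pos (by positivity)).ne'
  have h3 : Gamma δ ≠ 0 := (Gamma_pos_of_pos (by positivity)).ne'
  have h4 : Gamma (δ + l + v) ≠ 0 := (Gamma_pos_of_pos (by positivity)).ne'
  have h5 : Gamma (1 + l) ≠ 0 := (Gamma_pos_of_pos (by positivity)).ne'
  have h6 : Gamma (1 + v) ≠ 0 := (Gamma_pos_of_pos (by positivity)).ne'
  have h7 : (2 : ℝ) ^ (2 * δ + l + v) = 2 ^ (δ + l) * 2 ^ (δ + v) := by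
    rw [← rpow_add two_pos]; ring_nf
  have h8 : (2 : ℝ) ^ (δ + l) ≠ 0 := by positivity
  have h9 : (2 : ℝ) ^ (δ + v) ≠ 0 := by positivity
  have h10 : π ^ δ ≠ 0 := by positivity
  have h11 : δ + l + v ≠ 0 := by positivity
  simp only [klTerm, klRho, adsCoeff, le_refl, if_true, Nat.cast_zero, mul_zero, add_zero,
    Nat.factorial_zero, Nat.cast_one, mul_one, Gamma_one, one_mul, tsub_self]
  rw [e, show δ + (δ + l + v) = 2 * δ + l + v by ring, h7, add_comm l 1, add_comm v 1]
  generalize Gamma (1 + l + v) = x1 at *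
  generalize Gamma (2 * δ + l + v) = x2 at *
  generalize Gamma (δ + l + v) = x3 at *
  generalize (2 : ℝ) ^ (δ + l) = x4 at *
  generalize (2 : ℝ) ^ (δ + v) = x5 at *
  generalize π ^ δ = x6 at *
  field_simp
  ring

/-- The coefficients of the Källén–Lehmann expansion of a product of two propagators. -/
lemma sum_klTerm {δ l v : ℝ} (hδ : 0 < δ) (hl : 0 < l) (hv : 0 < v) (N : ℕ) :
    ∑ ij ∈ Finset.HasAntidiagonal.antidiagonal N, adsCoeff δ l ij.1 * adsCoeff δ v ij.2 =
      ∑ k ∈ Finset.range (N + 1), klTerm δ l v k N := by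
  obtain ⟨r, w, p, hp, hr0, hw0, h1, h2, h3⟩ := product_recursion hδ hl hv
  rw [← hp]
  set y : ℕ → ℝ := fun k => (δ + l + v + 2 * k) ^ 2 + δ ^ 2 - l ^ 2 - v ^ 2 with hy
  set t := klTerm δ l v with ht
  have hext : ∀ (f : ℕ → ℝ) (n : ℕ), ∑ k ∈ Finset.range (n + 1), f k * t k n =
      ∑ k ∈ Finset.range (n + 2), f k * t k n := fun f n => by
    rw [Finset.sum_range_succ _ (n + 1), ht, klTerm_of_lt _ _ _ (Nat.lt_succ_self n), mul_zero,
      add_zero]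
  have hrec : ∀ k n : ℕ, y k * t k (n + 1) =
      ((2 * δ + l + v + 2 * (n + 1 : ℕ)) * (l + v + 2 * (n + 1 : ℕ)) -
          (l ^ 2 + v ^ 2 - 2 * δ ^ 2)) * t k (n + 1) -
          (2 * δ + l + v + 2 * n) * (2 * δ + l + v + 2 * n + 1) * t k n := fun k n => by
    have := klTerm_succ_right hδ hl hv k n
    simp only [hy, ht]
    push_cast
    linear_combination -this
  have hp0 : p 0 = t 0 0 := by
    rw [hp, ht, klTerm_zero_zero hδ hl hv]
    simp
  refine eq_of_product_recursion (r := r) (w := w)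
    (p' := fun n => ∑ k ∈ Finset.range (n + 1), t k n)
    (r' := fun n => (∑ k ∈ Finset.range (n + 1), y k * t k n) / 2)
    (w' := fun n => (∑ k ∈ Finset.range (n + 1),
      ((y k - 4 * δ * (l + v + 2 * n)) * y k) * t k n) / 2)
    (g := fun n => (2 * δ + l + v + 2 * n) * (l + v + 2 * n) - (l ^ 2 + v ^ 2 - 2 * δ ^ 2))
    (h := fun n => (l + v + 2 * n) * (l + v + 2 * n - 2 * δ) - (l ^ 2 + v ^ 2 - 2 * δ ^ 2))
    (α := fun n => (2 * δ + l + v + 2 * n) * (2 * δ + l + v + 2 * n + 1))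
    (b := 4 * δ * (2 * δ - 1)) (c := (l ^ 2 - δ ^ 2) * (v ^ 2 - δ ^ 2))
    (fun n => ?_) ?_ ?_ ?_ h1 h2 h3 (fun n => ?_) (fun n => ?_) (fun n => ?_) N
  · have : 0 < 64 * ((n + 1) * (n + 1 + l) * (n + 1 + v) * (n + 1 + (l + v))) / 4 := by positivity
    push_cast
    refine ne_of_gt ?_
    linarith only [this, show ((l + v + 2 * (n + 1)) * (l + v + 2 * (n + 1) - 2 * δ) -
      (l ^ 2 + v ^ 2 - 2 * δ ^ 2)) * ((2 * δ + l + v + 2 * (n + 1)) * (l + v + 2 * (n + 1)) -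
      (l ^ 2 + v ^ 2 - 2 * δ ^ 2)) - 4 * ((l ^ 2 - δ ^ 2) * (v ^ 2 - δ ^ 2)) =
      64 * ((n + 1) * (n + 1 + l) * (n + 1 + v) * (n + 1 + (l + v))) / 4 by ring]
  · simpa using hp0
  · simp only [zero_add, Finset.range_one, Finset.sum_singleton]
    rw [hp0] at hr0
    simp only [hy]
    push_cast
    linear_combination hr0 / 2
  · simp only [zero_add, Finset.range_one, Finset.sum_singleton]
    rw [hp0] at hr0
    simp only [hy]
    push_cast
    linear_combination hw0 + ((l + v) * (l + v - 2 * δ) - (l ^ 2 + v ^ 2 - 2 * δ ^ 2)) * hr0 / 2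
  · have e : ∑ k ∈ Finset.range (n + 1), t k n = ∑ k ∈ Finset.range (n + 2), t k n := by
      simpa using hext (fun _ => 1) n
    simp only [e, mul_div_cancel₀ _ (two_ne_zero' ℝ)]
    rw [Finset.mul_sum, Finset.mul_sum, ← Finset.sum_sub_distrib]
    exact Finset.sum_congr rfl fun k _ => hrec k n
  · rw [hext y n, mul_div_assoc', mul_div_assoc', ← sub_div, Finset.mul_sum, Finset.mul_sum,
      ← Finset.sum_sub_distrib]
    congr 1
    refine Finset.sum_congr rfl fun k _ => ?_
    linear_combination y k * hrec k n
  · have e : ∑ k ∈ Finset.range (n + 1), t k n = ∑ k ∈ Finset.range (n + 2), t k n := by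
      simpa using hext (fun _ => 1) n
    have key := klTerm_telescope hδ hl hv n
    rw [hext (fun k => (y k - 4 * δ * (l + v + 2 * n)) * y k) n, hext y n, e]
    have key2 : ∑ k ∈ Finset.range (n + 2), (((y k - 4 * δ * (l + v + 2 * (n + 1 : ℕ))) * y k) *
        t k (n + 1) - ((y k - 4 * δ * (l + v + 2 * n)) * y k) * t k n +
        4 * δ * (2 * δ - 1) * (y k * t k n) -
        4 * ((l ^ 2 - δ ^ 2) * (v ^ 2 - δ ^ 2)) * (t k (n + 1) - t k n)) = 0 := by
      rw [← key]
      refine Finset.sum_congr rfl fun k _ => ?_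
      simp only [klSymbol]
      change _ = t k (n + 1) * ((_ + y k) * y k - _) - t k n * ((_ + y k) * y k - _)
      push_cast
      ring
    rw [Finset.sum_sub_distrib, Finset.sum_add_distrib, Finset.sum_sub_distrib, ← Finset.mul_sum,
      ← Finset.mul_sum, Finset.sum_sub_distrib] at key2
    linear_combination key2 / 2

lemma Gamma_add_nat {a : ℝ} (ha : 0 < a) (n : ℕ) :
    Gamma (a + n) = (ascPochhammer ℝ n).eval a * Gamma a := by
  induction n with
  | zero => simp
  | succ n ih =>
    rw [Nat.cast_succ, ← add_assoc, Gamma_add_one (by positivity), ih, ascPochhammer_succ_eval]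
    ring

/-- The coefficients of the hypergeometric series, normalised by Gamma functions. -/
noncomputable def hypTerm (a b c : ℝ) (n : ℕ) : ℝ :=
  Gamma (a + n) * Gamma (b + n) / (Gamma (c + n) * (n.factorial : ℝ))

lemma hypTerm_comm (a b c : ℝ) (n : ℕ) : hypTerm a b c n = hypTerm b a c n := by
  rw [hypTerm, hypTerm, mul_comm (Gamma (a + n))]

lemma hypTerm_pos {a b c : ℝ} (ha : 0 < a) (hb : 0 < b) (hc : 0 < c) (n : ℕ) :
    0 < hypTerm a b c n := by
  have h1 : 0 < Gamma (a + n) := Gamma_pos_of_pos (by positivity)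
  have h2 : 0 < Gamma (b + n) := Gamma_pos_of_pos (by positivity)
  have h3 : 0 < Gamma (c + n) := Gamma_pos_of_pos (by positivity)
  unfold hypTerm
  positivity

lemma hypTerm_succ {a b c : ℝ} (ha : 0 < a) (hb : 0 < b) (hc : 0 < c) (n : ℕ) :
    hypTerm a b c (n + 1) = hypTerm a b c n * ((a + n) / (c + n) * ((b + n) / (n + 1))) := by
  have h3 : Gamma (c + n) ≠ 0 := (Gamma_pos_of_pos (by positivity)).ne'
  unfold hypTerm
  rw [Nat.factorial_succ, Nat.cast_mul, Nat.cast_succ, ← add_assoc, ← add_assoc, ← add_assoc,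
    Gamma_add_one (by positivity), Gamma_add_one (by positivity), Gamma_add_one (by positivity)]
  field_simp

lemma tendsto_add_div_add (a b : ℝ) :
    Tendsto (fun n : ℕ => (a + n) / (b + n)) atTop (nhds 1) := by
  simpa using tendsto_add_mul_div_add_mul_atTop_nhds a b (1 : ℝ) one_ne_zero

lemma summable_hypTerm {a b c x : ℝ} (ha : 0 < a) (hb : 0 < b) (hc : 0 < c) (hx0 : 0 < x)
    (hx : x < 1) : Summable fun n : ℕ => hypTerm a b c n * x ^ n := by
  refine summable_of_ratio_test_tendsto_lt_one hx
    (Eventually.of_forall fun n => (mul_pos (hypTerm_pos ha hb hc n) (pow_pos hx0 n)).ne') ?_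
  have h : Tendsto (fun n : ℕ => (a + n) / (c + n) * ((b + n) / (1 + n)) * x) atTop (nhds x) := by
    simpa using ((tendsto_add_div_add a c).mul (tendsto_add_div_add b 1)).mul_const x
  refine h.congr fun n => ?_
  have h1 := hypTerm_pos ha hb hc n
  rw [hypTerm_succ ha hb hc, norm_of_nonneg (by positivity), norm_of_nonneg (by positivity),
    add_comm (n : ℝ) 1, pow_succ]
  field_simp

lemma adsCoeff_eq_hypTerm {δ μ : ℝ} (n : ℕ) :
    adsCoeff δ μ n =
      hypTerm ((δ + μ) / 2) ((δ + μ + 1) / 2) (μ + 1) n / (4 * π ^ (δ + 1 / 2)) := by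
  have h := Real.Gamma_mul_Gamma_add_half ((δ + μ) / 2 + n)
  have e1 : (δ + μ) / 2 + n + 1 / 2 = (δ + μ + 1) / 2 + n := by ring
  have e2 : 2 * ((δ + μ) / 2 + n) = δ + μ + 2 * n := by ring
  rw [e1, e2] at h
  rw [adsCoeff, hypTerm, h, rpow_sub two_pos, rpow_one, rpow_add pi_pos, ← sqrt_eq_rpow]
  have h1 : √π ≠ 0 := by positivity
  have h2 : π ^ δ ≠ 0 := by positivity
  have h3 : (2 : ℝ) ^ (δ + μ + 2 * n) ≠ 0 := by positivity
  by_cases h4 : Gamma (μ + 1 + n) = 0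
  · simp [h4]
  generalize √π = x1 at *
  generalize π ^ δ = x2 at *
  generalize (2 : ℝ) ^ (δ + μ + 2 * n) = x3 at *
  field_simp
  ring

lemma inv_sq_mem_Ioo {u : ℝ} (hu : 1 < u) : u⁻¹ ^ 2 ∈ Set.Ioo (0 : ℝ) 1 :=
  ⟨by positivity, pow_lt_one₀ (by positivity) (inv_lt_one_of_one_lt₀ hu) two_ne_zero⟩

lemma summable_adsCoeff_pow {δ μ : ℝ} (hδ : 0 < δ) (hμ : 0 < μ) (x : ℝ) (hx0 : 0 < x)
    (hx : x < 1) :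
    Summable fun n : ℕ => adsCoeff δ μ n * x ^ n := by
  refine ((summable_hypTerm (a := (δ + μ) / 2) (b := (δ + μ + 1) / 2) (c := μ + 1) (by positivity)
    (by positivity) (by positivity) hx0 hx).mul_right (4 * π ^ (δ + 1 / 2))⁻¹).congr fun n => ?_
  rw [adsCoeff_eq_hypTerm, div_eq_mul_inv]
  ring

lemma rpow_neg_add_two_mul {u : ℝ} (hu : 0 < u) (σ : ℝ) (n : ℕ) :
    u ^ (-(σ + 2 * n)) = u ^ (-σ) * (u⁻¹ ^ 2) ^ n := by
  rw [neg_add, rpow_add hu, ← pow_mul, inv_pow, rpow_neg hu.le (2 * n)]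
  congr 2
  exact_mod_cast rpow_natCast u (2 * n)

lemma hasSum_adsG {δ μ u : ℝ} (hδ : 0 < δ) (hμ : 0 < μ) (hu : 1 < u) :
    HasSum (fun n : ℕ => adsCoeff δ μ n * u ^ (-(δ + μ + 2 * n))) (adsG (2 * δ + 1) μ u) := by
  have hu0 : 0 < u := one_pos.trans hu
  have hs : Summable fun n : ℕ => adsCoeff δ μ n * u ^ (-(δ + μ + 2 * n)) := by
    refine ((summable_adsCoeff_pow hδ hμ _ (inv_sq_mem_Ioo hu).1
      (inv_sq_mem_Ioo hu).2).mul_left (u ^ (-(δ + μ)))).congr fun n => ?_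
    rw [rpow_neg_add_two_mul hu0]
    ring
  convert! hs.hasSum using 1
  rw [adsG, ← tsum_mul_left]
  refine tsum_congr fun n => ?_
  have hG : Gamma (μ + 1) ≠ 0 := (Gamma_pos_of_pos (by positivity)).ne'
  have e0 : Gamma ((2 * δ + 1 - 1) / 2 + μ) / (2 * π ^ ((2 * δ + 1 - 1) / 2) * Gamma (μ + 1) *
      (2 * u) ^ ((2 * δ + 1 - 1) / 2 + μ)) = adsCoeff δ μ 0 * u ^ (-(δ + μ)) := by
    rw [adsCoeff, show (2 * δ + 1 - 1) / 2 = δ by ring, mul_rpow two_pos.le hu0.le,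
      rpow_neg hu0.le]
    simp only [Nat.cast_zero, mul_zero, add_zero, Nat.factorial_zero, Nat.cast_one, mul_one]
    field_simp
  have e1 : u ^ (-(2 : ℝ) * n) = (u⁻¹ ^ 2) ^ n := by
    simpa [neg_mul] using rpow_neg_add_two_mul hu0 0 n
  have hc : (ascPochhammer ℝ n).eval (μ + 1) ≠ 0 := (ascPochhammer_pos n _ (by positivity)).ne'
  rw [e0, e1, rpow_neg_add_two_mul hu0, adsCoeff_eq_hypTerm, adsCoeff_eq_hypTerm, hypTerm, hypTerm,
    Gamma_add_nat (a := (δ + μ) / 2) (by positivity) n,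
    Gamma_add_nat (a := (δ + μ + 1) / 2) (by positivity) n,
    Gamma_add_nat (a := μ + 1) (by positivity) n,
    show (2 * δ + 1 - 1) / 4 + μ / 2 = (δ + μ) / 2 by ring,
    show (2 * δ + 1 + 1) / 4 + μ / 2 = (δ + μ + 1) / 2 by ring]
  simp only [Nat.cast_zero, add_zero, Nat.factorial_zero, Nat.cast_one, mul_one]
  generalize u ^ (-(δ + μ)) = x1
  generalize (u⁻¹ ^ 2) ^ n = x2
  generalize π ^ (δ + 1 / 2) = x3
  generalize Gamma ((δ + μ) / 2) = x4
  generalize Gamma ((δ + μ + 1) / 2) = x5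
  field_simp

lemma adsG_pos {δ μ u : ℝ} (hδ : 0 < δ) (hμ : 0 < μ) (hu : 1 < u) : 0 < adsG (2 * δ + 1) μ u := by
  have hu0 : 0 < u := one_pos.trans hu
  have h := hasSum_adsG hδ hμ hu
  have hp : ∀ n : ℕ, 0 < adsCoeff δ μ n * u ^ (-(δ + μ + 2 * n)) := fun n =>
    mul_pos (adsCoeff_pos (by positivity) hμ n) (by positivity)
  rw [← h.tsum_eq]
  exact h.summable.tsum_pos (fun n => (hp n).le) 0 (hp 0)

/-- Summing a nonnegative double sequence along antidiagonals and along rows agree. -/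
lemma hasSum_of_hasSum_antidiagonal {f : ℕ × ℕ → ℝ} {g : ℕ → ℝ} {S : ℝ} (hf : ∀ p, 0 ≤ f p)
    (h : HasSum (fun N : ℕ => ∑ ij ∈ Finset.HasAntidiagonal.antidiagonal N, f ij) S)
    (hg : ∀ k, HasSum (fun n => f (k, n)) (g k)) : HasSum g S := by
  set e := Finset.HasAntidiagonal.sigmaAntidiagonalEquivProd (A := ℕ)
  have hN : ∀ N : ℕ, HasSum (fun p : Finset.HasAntidiagonal.antidiagonal N => f (e ⟨N, p⟩))
      (∑ ij ∈ Finset.HasAntidiagonal.antidiagonal N, f ij) := fun N =>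
    Finset.hasSum (Finset.HasAntidiagonal.antidiagonal N) f
  have hs : Summable (f ∘ e) := by
    refine (summable_sigma_of_nonneg (f := f ∘ e) fun p => hf _).mpr
      ⟨fun N => (hN N).summable, h.summable.congr fun N => ?_⟩
    exact ((hN N).tsum_eq).symm
  have h1 := (e.summable_iff.mp hs).hasSum
  have h2 := (e.hasSum_iff.mpr h1).sigma hN
  rw [h.unique h2]
  exact h1.prod_fiberwise hg

/-- The Källén–Lehmann expansion of a product of two propagators. -/
lemma hasSum_klRho_mul_adsG {δ l v u : ℝ} (hδ : 0 < δ) (hl : 0 < l) (hv : 0 < v) (hu : 1 < u) :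
    HasSum (fun k : ℕ => klRho δ k l v * adsG (2 * δ + 1) (δ + l + v + 2 * k) u)
      (adsG (2 * δ + 1) l u * adsG (2 * δ + 1) v u) := by
  have hu0 : 0 < u := one_pos.trans hu
  have hl' := hasSum_adsG hδ hl hu
  have hv' := hasSum_adsG hδ hv hu
  have hlp : ∀ n : ℕ, 0 ≤ adsCoeff δ l n * u ^ (-(δ + l + 2 * n)) := fun n =>
    (mul_pos (adsCoeff_pos (by positivity) hl n) (by positivity)).le
  have hvp : ∀ n : ℕ, 0 ≤ adsCoeff δ v n * u ^ (-(δ + v + 2 * n)) := fun n =>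
    (mul_pos (adsCoeff_pos (by positivity) hv n) (by positivity)).le
  set f : ℕ → ℝ := fun n => adsCoeff δ l n * u ^ (-(δ + l + 2 * n)) with hf
  set g : ℕ → ℝ := fun n => adsCoeff δ v n * u ^ (-(δ + v + 2 * n)) with hg
  have hprod : Summable fun p : ℕ × ℕ => f p.1 * g p.2 :=
    hl'.summable.mul_of_nonneg hv'.summable hlp hvp
  have hsum : HasSum (fun N : ℕ => ∑ ij ∈ Finset.HasAntidiagonal.antidiagonal N,
      f ij.1 * g ij.2) (adsG (2 * δ + 1) l u * adsG (2 * δ + 1) v u) := by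
    rw [← hl'.tsum_eq, ← hv'.tsum_eq,
      hl'.summable.tsum_mul_tsum_eq_tsum_sum_antidiagonal hv'.summable hprod]
    exact (summable_sum_mul_antidiagonal_of_summable_mul hprod).hasSum
  have key : ∀ N : ℕ, ∑ ij ∈ Finset.HasAntidiagonal.antidiagonal N, f ij.1 * g ij.2 =
      ∑ ij ∈ Finset.HasAntidiagonal.antidiagonal N, klRho δ ij.1 l v *
        (adsCoeff δ (δ + l + v + 2 * ij.1) ij.2 *
          u ^ (-(δ + (δ + l + v + 2 * ij.1) + 2 * ij.2))) := fun N => by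
    have h1 : ∀ ij ∈ Finset.HasAntidiagonal.antidiagonal N, f ij.1 * g ij.2 =
        u ^ (-(2 * δ + l + v + 2 * N)) * (adsCoeff δ l ij.1 * adsCoeff δ v ij.2) := fun ij hij => by
      rw [← Finset.HasAntidiagonal.mem_antidiagonal.mp hij, hf, hg]
      dsimp only
      rw [show -(2 * δ + l + v + 2 * ((ij.1 + ij.2 : ℕ) : ℝ)) =
        -(δ + l + 2 * ij.1) + -(δ + v + 2 * ij.2) by push_cast; ring, rpow_add hu0]
      ring
    have h2 : ∀ ij ∈ Finset.HasAntidiagonal.antidiagonal N, klRho δ ij.1 l v *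
        (adsCoeff δ (δ + l + v + 2 * ij.1) ij.2 *
          u ^ (-(δ + (δ + l + v + 2 * ij.1) + 2 * ij.2))) =
        u ^ (-(2 * δ + l + v + 2 * N)) * klTerm δ l v ij.1 N := fun ij hij => by
      rw [← Finset.HasAntidiagonal.mem_antidiagonal.mp hij, klTerm_add,
        show -(δ + (δ + l + v + 2 * ij.1) + 2 * ij.2) =
          -(2 * δ + l + v + 2 * ((ij.1 + ij.2 : ℕ) : ℝ)) by push_cast; ring]
      ring
    rw [Finset.sum_congr rfl h1, Finset.sum_congr rfl h2, ← Finset.mul_sum, ← Finset.mul_sum,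
      sum_klTerm hδ hl hv, Finset.Nat.sum_antidiagonal_eq_sum_range_succ_mk]
  simp only [key] at hsum
  refine hasSum_of_hasSum_antidiagonal (f := fun p => klRho δ p.1 l v *
    (adsCoeff δ (δ + l + v + 2 * p.1) p.2 * u ^ (-(δ + (δ + l + v + 2 * p.1) + 2 * p.2))))
    (fun p => ?_) hsum fun k => ?_
  · have h1 := klRho_pos hδ hl hv p.1
    have h2 := adsCoeff_pos (δ := δ) (μ := δ + l + v + 2 * p.1) (by positivity) (by positivity) p.2
    positivity
  · exact (hasSum_adsG hδ (by positivity) hu).mul_left _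

lemma integrableOn_beta {p q : ℝ} (hp : 0 < p) (hq : 0 < q) :
    IntegrableOn (fun t : ℝ => t ^ (p - 1) * (1 - t) ^ (q - 1)) (Set.Ioo 0 1) ∧
      ∫ t in Set.Ioo (0 : ℝ) 1, t ^ (p - 1) * (1 - t) ^ (q - 1) =
        Gamma p * Gamma q / Gamma (p + q) := by
  have h0 := Complex.betaIntegral_convergent (u := p) (v := q) (by simpa) (by simpa)
  rw [intervalIntegrable_iff_integrableOn_Ioc_of_le zero_le_one] at h0
  have he : ∀ t ∈ Set.Ioc (0 : ℝ) 1,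
      ((t : ℂ) ^ ((p : ℂ) - 1) * (1 - (t : ℂ)) ^ ((q : ℂ) - 1)) =
        ((t ^ (p - 1) * (1 - t) ^ (q - 1) : ℝ) : ℂ) := by
    intro t ht
    rw [Complex.ofReal_mul, Complex.ofReal_cpow ht.1.le, Complex.ofReal_cpow (by linarith [ht.2])]
    push_cast
    rfl
  have h1 : IntegrableOn (fun t : ℝ => t ^ (p - 1) * (1 - t) ^ (q - 1)) (Set.Ioc 0 1) := by
    have h2 := (integrableOn_congr_fun he measurableSet_Ioc).mp h0
    exact h2.re
  refine ⟨h1.mono_set Set.Ioo_subset_Ioc_self, ?_⟩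
  have h3 := ProbabilityTheory.beta_eq_betaIntegralReal p q hp hq
  rw [ProbabilityTheory.beta, Complex.betaIntegral, intervalIntegral.integral_of_le zero_le_one,
    setIntegral_congr_fun measurableSet_Ioc he, integral_complex_ofReal, Complex.ofReal_re] at h3
  rw [← integral_Ioc_eq_integral_Ioo, h3]

lemma hasSum_one_sub_rpow_neg {a x : ℝ} (ha : 0 < a) (hx0 : 0 ≤ x) (hx : x < 1) :
    HasSum (fun n : ℕ => Gamma (a + n) / (Gamma a * (n.factorial : ℝ)) * x ^ n)
      ((1 - x) ^ (-a)) := by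
  have h := (Real.one_div_one_sub_rpow_hasFPowerSeriesOnBall_zero a).hasSum (y := x) (by
    simpa [enorm_eq_nnnorm, ← NNReal.coe_lt_coe, abs_of_nonneg hx0] using! hx)
  rw [rpow_neg (by linarith), ← one_div]
  convert! h using 1
  · funext n
    have h1 := Ring.factorial_nsmul_multichoose_eq_ascPochhammer a n
    rw [Ring.multichoose_eq, nsmul_eq_mul, Polynomial.ascPochhammer_smeval_eq_eval] at h1
    have h2 : (n.factorial : ℝ) ≠ 0 := by positivity
    have h3 := (Gamma_pos_of_pos ha).ne'
    rw [Gamma_add_nat ha, ← h1]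
    simp only [FormalMultilinearSeries.ofScalars_apply_eq, smul_eq_mul]
    field_simp
  · simp

/-- Euler's integral `∫₀¹ t ^ (p - 1) (1 - t) ^ (q - 1) (1 - x t) ^ (-s) dt`. -/
noncomputable def eulerInt (p q s x : ℝ) : ℝ :=
  ∫ t in Set.Ioo (0 : ℝ) 1, t ^ (p - 1) * (1 - t) ^ (q - 1) * (1 - x * t) ^ (-s)

lemma hasSum_eulerInt {a b c x : ℝ} (ha : 0 < a) (hb : 0 < b) (hc : b < c) (hx0 : 0 < x)
    (hx : x < 1) :
    HasSum (fun n : ℕ => hypTerm a b c n * x ^ n)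
      (Gamma a / Gamma (c - b) * eulerInt b (c - b) a x) := by
  have hq : 0 < c - b := by linarith
  have hGq := Gamma_pos_of_pos hq
  have hGa := Gamma_pos_of_pos ha
  set F : ℕ → ℝ → ℝ := fun n t => Gamma (a + n) / (Gamma a * (n.factorial : ℝ)) * x ^ n *
    (t ^ (b + n - 1) * (1 - t) ^ (c - b - 1)) with hF
  have hFi : ∀ n, IntegrableOn (F n) (Set.Ioo 0 1) := fun n =>
    ((integrableOn_beta (by positivity) hq).1).const_mul _
  have hFint : ∀ n, ∫ t in Set.Ioo (0 : ℝ) 1, F n t =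
      Gamma (c - b) / Gamma a * (hypTerm a b c n * x ^ n) := fun n => by
    rw [hF]
    simp only
    rw [integral_const_mul, (integrableOn_beta (by positivity) hq).2,
      show b + n + (c - b) = c + n by ring, hypTerm]
    field_simp
  have hFn : ∀ n, ∫ t in Set.Ioo (0 : ℝ) 1, ‖F n t‖ = ∫ t in Set.Ioo (0 : ℝ) 1, F n t := fun n => by
    refine setIntegral_congr_fun measurableSet_Ioo fun t ht => norm_of_nonneg ?_
    have h1 : 0 < Gamma (a + n) := Gamma_pos_of_pos (by positivity)
    have h2 : 0 ≤ (1 - t) ^ (c - b - 1) := rpow_nonneg (by linarith [ht.2]) _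
    have h3 : 0 ≤ t ^ (b + n - 1) := rpow_nonneg ht.1.le _
    positivity
  have hsum : Summable fun n => ∫ t in Set.Ioo (0 : ℝ) 1, ‖F n t‖ := by
    refine ((summable_hypTerm ha hb (hb.trans hc) hx0 hx).mul_left
      (Gamma (c - b) / Gamma a)).congr fun n => ?_
    rw [hFn, hFint]
  have h := hasSum_integral_of_summable_integral_norm hFi hsum
  have hI : ∫ t in Set.Ioo (0 : ℝ) 1, ∑' n, F n t = eulerInt b (c - b) a x := by
    refine setIntegral_congr_fun measurableSet_Ioo fun t ht => ?_
    have hxt : x * t < 1 := by nlinarith [ht.1, ht.2]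
    have h1 := (hasSum_one_sub_rpow_neg ha (mul_pos hx0 ht.1).le hxt).mul_left
      (t ^ (b - 1) * (1 - t) ^ (c - b - 1))
    refine Eq.trans (tsum_congr fun n => ?_) h1.tsum_eq
    rw [hF]
    simp only
    rw [show b + n - 1 = b - 1 + n by ring, rpow_add ht.1, rpow_natCast, mul_pow]
    ring
  rw [hI] at h
  convert! h.mul_left (Gamma a / Gamma (c - b)) using 1
  funext n
  rw [hFint]
  field_simp

lemma one_sub_mul_rpow_le {x t s : ℝ} (hx0 : 0 < x) (hx : x < 1) (ht : t ∈ Set.Ioo (0 : ℝ) 1) :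
    (1 - x * t) ^ (-s) ≤ (1 - t) ^ (-s) + 1 := by
  have h1 : 1 - t ≤ 1 - x * t := by nlinarith [ht.1, ht.2]
  have h2 : 1 - x * t ≤ 1 := by nlinarith [ht.1, ht.2]
  have h3 : 0 < 1 - t := by linarith [ht.2]
  rcases le_total 0 s with hs | hs
  · linarith [rpow_le_rpow_of_nonpos h3 h1 (neg_nonpos.mpr hs)]
  · linarith [rpow_le_one (h3.le.trans h1) h2 (neg_nonneg.mpr hs), rpow_nonneg h3.le (-s)]

lemma tendsto_eulerInt {p q s : ℝ} (hp : 0 < p) (hq : 0 < q) (hs : 0 < q - s) :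
    Tendsto (eulerInt p q s) (nhdsWithin 1 (Set.Iio 1))
      (nhds (Gamma p * Gamma (q - s) / Gamma (p + q - s))) := by
  have hlim := (integrableOn_beta hp hs).2
  rw [← add_sub_assoc] at hlim
  rw [← hlim]
  unfold eulerInt
  have hmul : ∀ t ∈ Set.Ioo (0 : ℝ) 1, t ^ (p - 1) * (1 - t) ^ (q - s - 1) =
      t ^ (p - 1) * (1 - t) ^ (q - 1) * (1 - t) ^ (-s) := fun t ht => by
    rw [mul_assoc, ← rpow_add (by linarith [ht.2])]
    ring_nf
  refine tendsto_integral_filter_of_dominated_convergence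
    (fun t => t ^ (p - 1) * (1 - t) ^ (q - s - 1) + t ^ (p - 1) * (1 - t) ^ (q - 1))
    (Eventually.of_forall fun x => ?_) ?_
    ((integrableOn_beta hp hs).1.add (integrableOn_beta hp hq).1) ?_
  · exact Measurable.aestronglyMeasurable (by fun_prop)
  · filter_upwards [Ioo_mem_nhdsLT (zero_lt_one' ℝ)] with x hx
    refine ae_restrict_of_forall_mem measurableSet_Ioo fun t ht => ?_
    have h1 : 0 ≤ t ^ (p - 1) * (1 - t) ^ (q - 1) :=
      mul_nonneg (rpow_nonneg ht.1.le _) (rpow_nonneg (by linarith [ht.2]) _)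
    have h2 : 0 ≤ 1 - x * t := by nlinarith [ht.1, ht.2, hx.1, hx.2]
    rw [norm_of_nonneg (mul_nonneg h1 (rpow_nonneg h2 _)), hmul t ht]
    linarith [mul_le_mul_of_nonneg_left (one_sub_mul_rpow_le (s := s) hx.1 hx.2 ht) h1]
  · refine ae_restrict_of_forall_mem measurableSet_Ioo fun t ht => ?_
    rw [hmul t ht]
    refine Tendsto.const_mul _ (Tendsto.rpow_const ?_ (Or.inl (by linarith [ht.2])))
    have : Continuous fun x : ℝ => 1 - x * t := by fun_prop
    simpa using (this.tendsto 1).mono_left nhdsWithin_le_nhds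

lemma eulerInt_le {p q a s x : ℝ} (hp : 0 < p) (hs0 : 0 ≤ s) (hsa : s ≤ a) (hq : 0 < q - a + s)
    (hx0 : 0 < x) (hx : x < 1) :
    eulerInt p q a x ≤ Gamma p * Gamma (q - a + s) / Gamma (p + (q - a + s)) * (1 - x) ^ (-s) := by
  rw [← (integrableOn_beta hp hq).2, eulerInt, ← integral_mul_const]
  refine integral_mono_of_nonneg (ae_restrict_of_forall_mem measurableSet_Ioo fun t ht => ?_)
    ((integrableOn_beta hp hq).1.mul_const _)
    (ae_restrict_of_forall_mem measurableSet_Ioo fun t ht => ?_)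
  · have h1 : 0 ≤ 1 - t := by linarith [ht.2]
    have h2 : 0 ≤ 1 - x * t := by nlinarith [ht.1, ht.2]
    have h3 := ht.1.le
    simp only [Pi.zero_apply]
    positivity
  · have h1 : 0 < 1 - t := by linarith [ht.2]
    have h2 : 1 - t ≤ 1 - x * t := by nlinarith [ht.1, ht.2]
    have h3 : 1 - x ≤ 1 - x * t := by nlinarith [ht.1, ht.2]
    have h4 : (0 : ℝ) < 1 - x := by linarith
    have h5 : (1 - x * t) ^ (-a) ≤ (1 - t) ^ (-(a - s)) * (1 - x) ^ (-s) := by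
      rw [show -a = -(a - s) + -s by ring, rpow_add (h4.trans_le h3)]
      exact mul_le_mul (rpow_le_rpow_of_nonpos h1 h2 (by linarith))
        (rpow_le_rpow_of_nonpos h4 h3 (by linarith)) (rpow_nonneg (h4.le.trans h3) _)
        (by positivity)
    have h6 : 0 ≤ t ^ (p - 1) * (1 - t) ^ (q - 1) :=
      mul_nonneg (rpow_nonneg ht.1.le _) (by positivity)
    have h7 : (1 - t) ^ (q - a + s - 1) = (1 - t) ^ (q - 1) * (1 - t) ^ (-(a - s)) := by
      rw [← rpow_add h1]
      ring_nf
    simp only [h7]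
    linarith [mul_le_mul_of_nonneg_left h5 h6]

lemma eulerInt_transform {p q s x : ℝ} (hx0 : 0 < x) (hx : x < 1) :
    eulerInt p q s x = (1 - x) ^ (q - s) * eulerInt q p (p + q - s) x := by
  set f : ℝ → ℝ := fun r => (1 - r) / (1 - x * r) with hf
  have hden : ∀ r ∈ Set.Ioo (0 : ℝ) 1, 0 < 1 - x * r := fun r hr => by nlinarith [hr.1, hr.2]
  have h1f : ∀ r ∈ Set.Ioo (0 : ℝ) 1, 1 - f r = r * (1 - x) / (1 - x * r) := fun r hr => by
    have := (hden r hr).ne'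
    rw [eq_div_iff this, sub_mul, div_mul_cancel₀ _ this]
    ring
  have hxf : ∀ r ∈ Set.Ioo (0 : ℝ) 1, 1 - x * f r = (1 - x) / (1 - x * r) := fun r hr => by
    have := (hden r hr).ne'
    rw [eq_div_iff this, sub_mul, mul_assoc, div_mul_cancel₀ _ this]
    ring
  have hx1 : 0 < 1 - x := by linarith
  have hmaps : ∀ r ∈ Set.Ioo (0 : ℝ) 1, f r ∈ Set.Ioo (0 : ℝ) 1 := fun r hr => by
    have h1 := hden r hr
    have h2 : 0 < f r := div_pos (by linarith [hr.2]) h1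
    have h3 : 0 < 1 - f r := by
      rw [h1f r hr]
      exact div_pos (mul_pos hr.1 hx1) h1
    exact ⟨h2, by linarith⟩
  have hinv : ∀ r ∈ Set.Ioo (0 : ℝ) 1, f (f r) = r := fun r hr => by
    have h1 := (hden r hr).ne'
    change (1 - f r) / (1 - x * f r) = r
    rw [h1f r hr, hxf r hr, div_div_div_cancel_right₀ h1, mul_div_cancel_right₀ _ hx1.ne']
  have himg : f '' Set.Ioo 0 1 = Set.Ioo 0 1 :=
    Set.Subset.antisymm (Set.image_subset_iff.mpr hmaps) fun r hr => ⟨f r, hmaps r hr, hinv r hr⟩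
  have hinj : Set.InjOn f (Set.Ioo 0 1) := Set.LeftInvOn.injOn hinv
  have hder : ∀ r ∈ Set.Ioo (0 : ℝ) 1,
      HasDerivWithinAt f (-(1 - x) / (1 - x * r) ^ 2) (Set.Ioo 0 1) r := fun r hr => by
    have h1 : HasDerivAt (fun r : ℝ => 1 - r) (-1) r := by
      simpa using (hasDerivAt_id r).const_sub 1
    have h2 : HasDerivAt (fun r : ℝ => 1 - x * r) (-x) r := by
      simpa using ((hasDerivAt_id r).const_mul x).const_sub 1
    convert! (h1.div h2 (hden r hr).ne').hasDerivWithinAt using 1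
    ring
  have h := integral_image_eq_integral_abs_deriv_smul measurableSet_Ioo hder hinj
    (fun t : ℝ => t ^ (p - 1) * (1 - t) ^ (q - 1) * (1 - x * t) ^ (-s))
  rw [himg] at h
  rw [eulerInt, h, eulerInt, ← integral_const_mul]
  refine setIntegral_congr_fun measurableSet_Ioo fun r hr => ?_
  have hd := hden r hr
  have hr1 : 0 < 1 - r := by linarith [hr.2]
  simp only [smul_eq_mul]
  rw [h1f r hr, hxf r hr, hf, abs_of_neg (div_neg_of_neg_of_pos (by linarith) (by positivity))]
  simp only
  rw [div_rpow hr1.le hd.le, div_rpow (mul_pos hr.1 hx1).le hd.le, div_rpow hx1.le hd.le,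
    mul_rpow hr.1.le hx1.le, show -(p + q - s) = -((p - 1) + (q - 1) + -s + (2 : ℕ)) by
      push_cast; ring, show q - s = q - 1 + -s + 1 by ring, rpow_add hx1, rpow_add hx1, rpow_one,
    rpow_neg hd.le (_ + _), rpow_add hd, rpow_add hd, rpow_add hd, rpow_natCast]
  have e1 := (rpow_pos_of_pos hd (p - 1)).ne'
  have e2 := (rpow_pos_of_pos hd (q - 1)).ne'
  have e3 := (rpow_pos_of_pos hd (-s)).ne'
  generalize (1 - x * r) ^ (p - 1) = y1 at *
  generalize (1 - x * r) ^ (q - 1) = y2 at *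
  generalize (1 - x * r) ^ (-s) = y3 at *
  generalize 1 - x * r = y at *
  have := hd.ne'
  field_simp

lemma hasSum_mul_rpow_neg {c : ℕ → ℝ} {u S : ℝ} (hu : 1 < u) (σ : ℝ)
    (hs : HasSum (fun n : ℕ => c n * (u⁻¹ ^ 2) ^ n) S) :
    HasSum (fun n : ℕ => c n * u ^ (-(σ + 2 * n))) (u ^ (-σ) * S) := by
  convert! hs.mul_left (u ^ (-σ)) using 1
  funext n
  rw [rpow_neg_add_two_mul (one_pos.trans hu)]
  ring

lemma summable_mul_rpow_neg {c : ℕ → ℝ} {u : ℝ} (hu : 1 < u) (σ : ℝ)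
    (hs : ∀ x, 0 < x → x < 1 → Summable fun n : ℕ => c n * x ^ n) :
    Summable fun n : ℕ => c n * u ^ (-(σ + 2 * n)) :=
  (hasSum_mul_rpow_neg hu σ (hs _ (inv_sq_mem_Ioo hu).1 (inv_sq_mem_Ioo hu).2).hasSum).summable

lemma hasDerivAt_tsum_mul_rpow_neg {c : ℕ → ℝ} {σ u : ℝ} (hσ : 0 < σ) (hc : ∀ n, 0 ≤ c n)
    (hs : ∀ x, 0 < x → x < 1 → Summable fun n : ℕ => c n * x ^ n)
    (hs' : ∀ x, 0 < x → x < 1 → Summable fun n : ℕ => (σ + 2 * n) * c n * x ^ n) (hu : 1 < u) :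
    HasDerivAt (fun u : ℝ => ∑' n : ℕ, c n * u ^ (-(σ + 2 * n)))
      (-∑' n : ℕ, (σ + 2 * n) * c n * u ^ (-(σ + 1 + 2 * n))) u := by
  obtain ⟨v, hv1, hvu⟩ := exists_between hu
  have h := hasDerivAt_tsum_of_isPreconnected (t := Set.Ioi v) (y₀ := u) (y := u)
    (g := fun (n : ℕ) (u : ℝ) => c n * u ^ (-(σ + 2 * n)))
    (g' := fun (n : ℕ) (u : ℝ) => -((σ + 2 * n) * c n * u ^ (-(σ + 1 + 2 * n))))
    (summable_mul_rpow_neg hv1 (σ + 1) hs') isOpen_Ioi isPreconnected_Ioi ?_ ?_ hvu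
    (summable_mul_rpow_neg hu σ hs) hvu
  · rwa [tsum_neg] at h
  · intro n y hy
    have hy0 : 0 < y := one_pos.trans (hv1.trans hy)
    convert! (Real.hasDerivAt_rpow_const (p := -(σ + 2 * n)) (Or.inl hy0.ne')).const_mul
      (c n) using 1
    rw [show -(σ + 2 * n) - 1 = -(σ + 1 + 2 * n) by ring]
    ring
  · intro n y hy
    have hv0 : 0 < v := one_pos.trans hv1
    have hy0 : 0 < y := hv0.trans hy
    have h1 := hc n
    rw [norm_neg, norm_of_nonneg (by positivity)]
    have h2 : y ^ (-(σ + 1 + 2 * n)) ≤ v ^ (-(σ + 1 + 2 * n)) :=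
      rpow_le_rpow_of_nonpos hv0 (le_of_lt hy) (by simp only [Left.neg_nonpos_iff]; positivity)
    gcongr

lemma add_mul_hypTerm {a b c : ℝ} (ha : 0 < a) (n : ℕ) :
    (2 * a + 2 * n) * hypTerm a b c n = 2 * hypTerm (a + 1) b c n := by
  rw [hypTerm, hypTerm, show a + 1 + n = a + n + 1 by ring, Gamma_add_one (by positivity)]
  ring

lemma adsCoeff_mul_eq {δ μ : ℝ} (h : 0 < δ + μ) (n : ℕ) :
    (δ + μ + 2 * n) * adsCoeff δ μ n = 2 *
      hypTerm ((δ + μ) / 2 + 1) ((δ + μ + 1) / 2) (μ + 1) n / (4 * π ^ (δ + 1 / 2)) := by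
  rw [adsCoeff_eq_hypTerm, ← add_mul_hypTerm (half_pos h)]
  ring

lemma adsCoeff_mul_mul_eq {δ μ : ℝ} (h : 0 < δ + μ) (n : ℕ) :
    (δ + μ + 1 + 2 * n) * ((δ + μ + 2 * n) * adsCoeff δ μ n) = 4 *
      hypTerm ((δ + μ) / 2 + 1) ((δ + μ + 1) / 2 + 1) (μ + 1) n / (4 * π ^ (δ + 1 / 2)) := by
  have h1 := add_mul_hypTerm (a := (δ + μ + 1) / 2) (b := (δ + μ) / 2 + 1) (c := μ + 1)
    (by linarith) n
  rw [adsCoeff_mul_eq h, hypTerm_comm ((δ + μ) / 2 + 1) ((δ + μ + 1) / 2 + 1),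
    hypTerm_comm ((δ + μ) / 2 + 1) ((δ + μ + 1) / 2)]
  linear_combination 2 / (4 * π ^ (δ + 1 / 2)) * h1

/-- Minus the derivative of the propagator. -/
noncomputable def adsG₁ (δ μ u : ℝ) : ℝ :=
  ∑' n : ℕ, (δ + μ + 2 * n) * adsCoeff δ μ n * u ^ (-(δ + μ + 1 + 2 * n))

/-- The second derivative of the propagator. -/
noncomputable def adsG₂ (δ μ u : ℝ) : ℝ :=
  ∑' n : ℕ, (δ + μ + 1 + 2 * n) * ((δ + μ + 2 * n) * adsCoeff δ μ n) *
    u ^ (-(δ + μ + 1 + 1 + 2 * n))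

section

variable {δ μ : ℝ}

lemma summable_mul_adsCoeff_pow (hδ : 0 < δ) (hμ : 0 < μ) (x : ℝ) (hx0 : 0 < x) (hx : x < 1) :
    Summable fun n : ℕ => (δ + μ + 2 * n) * adsCoeff δ μ n * x ^ n := by
  refine ((summable_hypTerm (a := (δ + μ) / 2 + 1) (b := (δ + μ + 1) / 2) (c := μ + 1)
    (by positivity) (by positivity) (by positivity) hx0 hx).mul_right
    (2 * (4 * π ^ (δ + 1 / 2))⁻¹)).congr fun n => ?_
  rw [adsCoeff_mul_eq (by positivity), div_eq_mul_inv]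
  ring

lemma summable_mul_mul_adsCoeff_pow (hδ : 0 < δ) (hμ : 0 < μ) (x : ℝ) (hx0 : 0 < x) (hx : x < 1) :
    Summable fun n : ℕ =>
      (δ + μ + 1 + 2 * n) * ((δ + μ + 2 * n) * adsCoeff δ μ n) * x ^ n := by
  refine ((summable_hypTerm (a := (δ + μ) / 2 + 1) (b := (δ + μ + 1) / 2 + 1) (c := μ + 1)
    (by positivity) (by positivity) (by positivity) hx0 hx).mul_right
    (4 * (4 * π ^ (δ + 1 / 2))⁻¹)).congr fun n => ?_
  rw [adsCoeff_mul_mul_eq (by positivity), div_eq_mul_inv]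
  ring

lemma hasDerivAt_adsG {u : ℝ} (hδ : 0 < δ) (hμ : 0 < μ) (hu : 1 < u) :
    HasDerivAt (adsG (2 * δ + 1) μ) (-adsG₁ δ μ u) u := by
  have h := hasDerivAt_tsum_mul_rpow_neg (σ := δ + μ) (by positivity)
    (fun n => (adsCoeff_pos (by positivity) hμ n).le) (summable_adsCoeff_pow hδ hμ)
    (summable_mul_adsCoeff_pow hδ hμ) hu
  refine h.congr_of_eventuallyEq ?_
  filter_upwards [Ioi_mem_nhds hu] with y hy
  exact (hasSum_adsG hδ hμ hy).tsum_eq.symm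

lemma hasDerivAt_adsG₁ {u : ℝ} (hδ : 0 < δ) (hμ : 0 < μ) (hu : 1 < u) :
    HasDerivAt (adsG₁ δ μ) (-adsG₂ δ μ u) u :=
  hasDerivAt_tsum_mul_rpow_neg (σ := δ + μ + 1) (by positivity)
    (fun n => mul_nonneg (by positivity) (adsCoeff_pos (by positivity) hμ n).le)
    (summable_mul_adsCoeff_pow hδ hμ) (summable_mul_mul_adsCoeff_pow hδ hμ) hu

lemma adsG_ode {u : ℝ} (hδ : 0 < δ) (hμ : 0 < μ) (hu : 1 < u) :
    (u ^ 2 - 1) * adsG₂ δ μ u - (2 * δ + 1) * u * adsG₁ δ μ u =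
      (μ ^ 2 - δ ^ 2) * adsG (2 * δ + 1) μ u := by
  have hu0 : 0 < u := one_pos.trans hu
  have h0 := hasSum_adsG hδ hμ hu
  have h1 := (summable_mul_rpow_neg hu (δ + μ + 1) (summable_mul_adsCoeff_pow hδ hμ)).hasSum
  have h2 := (summable_mul_rpow_neg hu (δ + μ + 1 + 1)
    (summable_mul_mul_adsCoeff_pow hδ hμ)).hasSum
  set T : ℕ → ℝ := fun n => 4 * n * (μ + n) * adsCoeff δ μ n * u ^ (-(δ + μ + 2 * n)) with hT
  have hsucc : HasSum (fun n => T (n + 1)) (adsG₂ δ μ u) := by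
    convert! h2 using 1
    funext n
    have := adsCoeff_succ (δ := δ) (μ := μ) (by positivity) hμ n
    simp only [hT]
    push_cast
    rw [show -(δ + μ + 2 * ((n : ℝ) + 1)) = -(δ + μ + 1 + 1 + 2 * n) by ring]
    linear_combination u ^ (-(δ + μ + 1 + 1 + 2 * (n : ℝ))) * this
  have hT2 : HasSum T (adsG₂ δ μ u) := by
    have := (hasSum_nat_add_iff (f := T) 1).mp hsucc
    simpa [hT] using this
  have hT' := ((h2.mul_left (u ^ 2)).sub (h1.mul_left ((2 * δ + 1) * u))).sub
    (h0.mul_left (μ ^ 2 - δ ^ 2))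
  have hTT : HasSum T (u ^ 2 * adsG₂ δ μ u - (2 * δ + 1) * u * adsG₁ δ μ u -
      (μ ^ 2 - δ ^ 2) * adsG (2 * δ + 1) μ u) := by
    convert! hT' using 1
    funext n
    simp only [hT]
    rw [show -(δ + μ + 2 * (n : ℝ)) = -(δ + μ + 1 + 1 + 2 * n) + 1 + 1 by ring,
      show -(δ + μ + 1 + 2 * (n : ℝ)) = -(δ + μ + 1 + 1 + 2 * n) + 1 by ring, rpow_add_one hu0.ne',
      rpow_add_one hu0.ne']
    ring
  linear_combination hTT.unique hT2

lemma tsum_mul_rpow_neg_le {c : ℕ → ℝ} {σ : ℝ} (hc : ∀ n, 0 ≤ c n)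
    (hs : ∀ x, 0 < x → x < 1 → Summable fun n : ℕ => c n * x ^ n) :
    ∃ C, 0 ≤ C ∧ ∀ u : ℝ, 2 ≤ u → ∑' n : ℕ, c n * u ^ (-(σ + 2 * n)) ≤ C * u ^ (-σ) := by
  refine ⟨∑' n, c n * (1 / 4) ^ n, tsum_nonneg fun n => mul_nonneg (hc n) (by positivity),
    fun u hu => ?_⟩
  have hu1 : 1 < u := by linarith
  have h1 := hs _ (inv_sq_mem_Ioo hu1).1 (inv_sq_mem_Ioo hu1).2
  rw [(hasSum_mul_rpow_neg hu1 σ h1.hasSum).tsum_eq, mul_comm]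
  refine mul_le_mul_of_nonneg_right ?_ (by positivity)
  refine h1.tsum_le_tsum (fun n => ?_) (hs (1 / 4) (by norm_num) (by norm_num))
  refine mul_le_mul_of_nonneg_left (pow_le_pow_left₀ (by positivity) ?_ n) (hc n)
  rw [inv_pow, one_div]
  exact inv_anti₀ (by norm_num) (by nlinarith)

lemma adsG_le_of_two_le (hδ : 0 < δ) (hμ : 0 < μ) :
    ∃ C, 0 ≤ C ∧ ∀ u : ℝ, 2 ≤ u → adsG (2 * δ + 1) μ u ≤ C * u ^ (-(δ + μ)) := by
  obtain ⟨C, hC0, hC⟩ := tsum_mul_rpow_neg_le (σ := δ + μ)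
    (fun n => (adsCoeff_pos (δ := δ) (by positivity) hμ n).le) (summable_adsCoeff_pow hδ hμ)
  refine ⟨C, hC0, fun u hu => ?_⟩
  rw [← (hasSum_adsG hδ hμ (by linarith)).tsum_eq]
  exact hC u hu

lemma adsG₁_le_of_two_le (hδ : 0 < δ) (hμ : 0 < μ) :
    ∃ C, 0 ≤ C ∧ ∀ u : ℝ, 2 ≤ u → adsG₁ δ μ u ≤ C * u ^ (-(δ + μ + 1)) :=
  tsum_mul_rpow_neg_le (σ := δ + μ + 1)
    (fun n => mul_nonneg (by positivity) (adsCoeff_pos (by positivity) hμ n).le)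
    (summable_mul_adsCoeff_pow hδ hμ)

lemma adsG₁_nonneg {u : ℝ} (hδ : 0 < δ) (hμ : 0 < μ) (hu : 1 < u) : 0 ≤ adsG₁ δ μ u :=
  tsum_nonneg fun n => mul_nonneg
    (mul_nonneg (by positivity) (adsCoeff_pos (by positivity) hμ n).le)
    (rpow_nonneg (one_pos.trans hu).le _)

end

lemma sq_sub_one_rpow {u : ℝ} (hu : 1 < u) (s : ℝ) :
    (u ^ 2 - 1) ^ s = u ^ (2 * s) * (1 - u⁻¹ ^ 2) ^ s := by
  have hu0 : 0 < u := one_pos.trans hu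
  have h1 := (inv_sq_mem_Ioo hu).2
  rw [show u ^ 2 - 1 = u ^ 2 * (1 - u⁻¹ ^ 2) by field_simp,
    mul_rpow (by positivity) (by linarith), ← rpow_natCast, ← rpow_mul hu0.le, Nat.cast_ofNat]

lemma adsG_eq_eulerInt {δ μ u : ℝ} (hδ : 0 < δ) (hδ1 : δ < 1) (hμ : 0 < μ) (hu : 1 < u) :
    adsG (2 * δ + 1) μ u = u ^ (-(δ + μ)) *
      (Gamma ((δ + μ) / 2) / Gamma ((1 - δ + μ) / 2) *
        eulerInt ((δ + μ + 1) / 2) ((1 - δ + μ) / 2) ((δ + μ) / 2) (u⁻¹ ^ 2) /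
        (4 * π ^ (δ + 1 / 2))) := by
  have hx := inv_sq_mem_Ioo hu
  have h := (hasSum_eulerInt (a := (δ + μ) / 2) (b := (δ + μ + 1) / 2) (c := μ + 1)
    (by positivity) (by positivity) (by linarith) hx.1 hx.2).div_const (4 * π ^ (δ + 1 / 2))
  rw [show μ + 1 - (δ + μ + 1) / 2 = (1 - δ + μ) / 2 by ring] at h
  refine (hasSum_adsG hδ hμ hu).unique (hasSum_mul_rpow_neg hu (δ + μ) ?_)
  convert! h using 1
  funext n
  rw [adsCoeff_eq_hypTerm]
  ring

lemma adsG_eq_eulerInt_swap {δ μ u : ℝ} (hδ : 0 < δ) (hδ1 : δ < 1) (hμ : 0 < μ) (hu : 1 < u) :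
    adsG (2 * δ + 1) μ u = u ^ (-(δ + μ)) *
      (Gamma ((δ + μ + 1) / 2) / Gamma ((2 - δ + μ) / 2) *
        eulerInt ((δ + μ) / 2) ((2 - δ + μ) / 2) ((δ + μ + 1) / 2) (u⁻¹ ^ 2) /
        (4 * π ^ (δ + 1 / 2))) := by
  have hx := inv_sq_mem_Ioo hu
  have h := (hasSum_eulerInt (a := (δ + μ + 1) / 2) (b := (δ + μ) / 2) (c := μ + 1)
    (by positivity) (by positivity) (by linarith) hx.1 hx.2).div_const (4 * π ^ (δ + 1 / 2))
  rw [show μ + 1 - (δ + μ) / 2 = (2 - δ + μ) / 2 by ring] at h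
  refine (hasSum_adsG hδ hμ hu).unique (hasSum_mul_rpow_neg hu (δ + μ) ?_)
  convert! h using 1
  funext n
  rw [adsCoeff_eq_hypTerm, hypTerm_comm]
  ring

lemma adsG₁_eq_eulerInt {δ μ u : ℝ} (hδ : 0 < δ) (hδ1 : δ < 1) (hμ : 0 < μ) (hu : 1 < u) :
    adsG₁ δ μ u = u ^ (-(δ + μ + 1)) *
      (2 * (Gamma ((δ + μ) / 2 + 1) / Gamma ((1 - δ + μ) / 2) *
        eulerInt ((δ + μ + 1) / 2) ((1 - δ + μ) / 2) ((δ + μ) / 2 + 1) (u⁻¹ ^ 2) /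
        (4 * π ^ (δ + 1 / 2)))) := by
  have hx := inv_sq_mem_Ioo hu
  have h := ((hasSum_eulerInt (a := (δ + μ) / 2 + 1) (b := (δ + μ + 1) / 2) (c := μ + 1)
    (by positivity) (by positivity) (by linarith) hx.1 hx.2).div_const
    (4 * π ^ (δ + 1 / 2))).mul_left 2
  rw [show μ + 1 - (δ + μ + 1) / 2 = (1 - δ + μ) / 2 by ring] at h
  refine HasSum.tsum_eq (hasSum_mul_rpow_neg hu (δ + μ + 1) ?_)
  convert! h using 1
  funext n
  rw [adsCoeff_mul_eq (by positivity)]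
  ring

/-- The ratio of Gamma functions through which a mass enters the one-loop integral. -/
noncomputable def massRatio (δ μ : ℝ) : ℝ := Gamma (δ + μ) / Gamma (1 - δ + μ)

lemma massRatio_pos {δ μ : ℝ} (hδ : 0 < δ) (hδ1 : δ < 1) (hμ : 0 < μ) : 0 < massRatio δ μ :=
  div_pos (Gamma_pos_of_pos (by positivity)) (Gamma_pos_of_pos (by linarith))

lemma massRatio_one_sub (δ μ : ℝ) : massRatio (1 - δ) μ = (massRatio δ μ)⁻¹ := by
  rw [massRatio, massRatio, inv_div, sub_sub_cancel]

lemma Gamma_ratio_eq_massRatio (δ μ : ℝ) :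
    Gamma ((δ + μ) / 2) * Gamma ((δ + μ + 1) / 2) /
      (Gamma ((1 - δ + μ) / 2) * Gamma ((2 - δ + μ) / 2)) =
      massRatio δ μ * 2 ^ (1 - 2 * δ) := by
  have h1 := Real.Gamma_mul_Gamma_add_half ((δ + μ) / 2)
  have h2 := Real.Gamma_mul_Gamma_add_half ((1 - δ + μ) / 2)
  rw [show (δ + μ) / 2 + 1 / 2 = (δ + μ + 1) / 2 by ring, mul_div_cancel₀ _ two_ne_zero] at h1
  rw [show (1 - δ + μ) / 2 + 1 / 2 = (2 - δ + μ) / 2 by ring, mul_div_cancel₀ _ two_ne_zero] at h2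
  have h3 : (2 : ℝ) ^ (1 - (δ + μ)) = 2 ^ (1 - (1 - δ + μ)) * 2 ^ (1 - 2 * δ) := by
    rw [← rpow_add two_pos]
    ring_nf
  have h4 : √π ≠ 0 := by positivity
  have h5 : (2 : ℝ) ^ (1 - (1 - δ + μ)) ≠ 0 := by positivity
  rw [h1, h2, massRatio, h3]
  field_simp

lemma tendsto_inv_sq_nhdsGT :
    Tendsto (fun u : ℝ => u⁻¹ ^ 2) (nhdsWithin 1 (Set.Ioi 1)) (nhdsWithin 1 (Set.Iio 1)) := by
  refine tendsto_nhdsWithin_iff.mpr ⟨?_, ?_⟩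
  · have : ContinuousAt (fun u : ℝ => u⁻¹ ^ 2) 1 := by fun_prop (disch := norm_num)
    simpa using this.tendsto.mono_left nhdsWithin_le_nhds
  · filter_upwards [self_mem_nhdsWithin] with u hu
    exact (inv_sq_mem_Ioo hu).2

lemma tendsto_rpow_nhdsGT_one (s : ℝ) :
    Tendsto (fun u : ℝ => u ^ s) (nhdsWithin 1 (Set.Ioi 1)) (nhds 1) := by
  have := (Real.continuousAt_rpow_const 1 s (Or.inl one_ne_zero)).tendsto
  rw [one_rpow] at this
  exact this.mono_left nhdsWithin_le_nhds

lemma tendsto_adsG {δ μ : ℝ} (hδ : 0 < δ) (hδ1 : δ < 1 / 2) (hμ : 0 < μ) :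
    Tendsto (adsG (2 * δ + 1) μ) (nhdsWithin 1 (Set.Ioi 1))
      (nhds (massRatio δ μ * 2 ^ (1 - 2 * δ) * Gamma (1 / 2 - δ) / (4 * π ^ (δ + 1 / 2)))) := by
  have h1 := (tendsto_eulerInt (p := (δ + μ + 1) / 2) (q := (1 - δ + μ) / 2) (s := (δ + μ) / 2)
    (by positivity) (by linarith) (by linarith)).comp tendsto_inv_sq_nhdsGT
  have h2 := (tendsto_rpow_nhdsGT_one (-(δ + μ))).mul ((h1.const_mul
    (Gamma ((δ + μ) / 2) / Gamma ((1 - δ + μ) / 2))).div_const (4 * π ^ (δ + 1 / 2)))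
  rw [← Gamma_ratio_eq_massRatio]
  have he : 1 * (Gamma ((δ + μ) / 2) / Gamma ((1 - δ + μ) / 2) *
      (Gamma ((δ + μ + 1) / 2) * Gamma ((1 - δ + μ) / 2 - (δ + μ) / 2) /
      Gamma ((δ + μ + 1) / 2 + (1 - δ + μ) / 2 - (δ + μ) / 2)) / (4 * π ^ (δ + 1 / 2))) =
      Gamma ((δ + μ) / 2) * Gamma ((δ + μ + 1) / 2) /
      (Gamma ((1 - δ + μ) / 2) * Gamma ((2 - δ + μ) / 2)) * Gamma (1 / 2 - δ) /
      (4 * π ^ (δ + 1 / 2)) := by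
    rw [show (1 - δ + μ) / 2 - (δ + μ) / 2 = 1 / 2 - δ by ring,
      show (δ + μ + 1) / 2 + (1 - δ + μ) / 2 - (δ + μ) / 2 = (2 - δ + μ) / 2 by ring]
    ring
  rw [he] at h2
  refine h2.congr' ?_
  filter_upwards [self_mem_nhdsWithin] with u hu
  rw [adsG_eq_eulerInt hδ (by linarith) hμ hu]
  rfl

lemma tendsto_adsG₁ {δ μ : ℝ} (hδ : 0 < δ) (hδ1 : δ < 1) (hμ : 0 < μ) :
    Tendsto (fun u => (u ^ 2 - 1) ^ (δ + 1 / 2) * adsG₁ δ μ u) (nhdsWithin 1 (Set.Ioi 1))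
      (nhds (Gamma (δ + 1 / 2) / (2 * π ^ (δ + 1 / 2)))) := by
  have h1 := (tendsto_eulerInt (p := (1 - δ + μ) / 2) (q := (δ + μ + 1) / 2)
    (s := (δ + μ + 1) / 2 + (1 - δ + μ) / 2 - ((δ + μ) / 2 + 1))
    (by linarith) (by positivity) (by linarith)).comp tendsto_inv_sq_nhdsGT
  have h2 := (tendsto_rpow_nhdsGT_one (2 * (δ + 1 / 2) - (δ + μ + 1))).mul ((h1.const_mul
    (Gamma ((δ + μ) / 2 + 1) / Gamma ((1 - δ + μ) / 2))).const_mul (2 / (4 * π ^ (δ + 1 / 2))))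
  have hG1 : Gamma ((δ + μ) / 2 + 1) ≠ 0 := (Gamma_pos_of_pos (by positivity)).ne'
  have hG2 : Gamma ((1 - δ + μ) / 2) ≠ 0 := (Gamma_pos_of_pos (by linarith)).ne'
  rw [show (δ + μ + 1) / 2 - ((δ + μ + 1) / 2 + (1 - δ + μ) / 2 - ((δ + μ) / 2 + 1)) =
    δ + 1 / 2 by ring, show (1 - δ + μ) / 2 + (δ + μ + 1) / 2 -
    ((δ + μ + 1) / 2 + (1 - δ + μ) / 2 - ((δ + μ) / 2 + 1)) = (δ + μ) / 2 + 1 by ring] at h2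
  have he : 1 * (2 / (4 * π ^ (δ + 1 / 2)) * (Gamma ((δ + μ) / 2 + 1) / Gamma ((1 - δ + μ) / 2) *
      (Gamma ((1 - δ + μ) / 2) * Gamma (δ + 1 / 2) / Gamma ((δ + μ) / 2 + 1)))) =
      Gamma (δ + 1 / 2) / (2 * π ^ (δ + 1 / 2)) := by
    generalize π ^ (δ + 1 / 2) = y
    field_simp
    norm_num
  rw [he] at h2
  refine h2.congr' ?_
  filter_upwards [self_mem_nhdsWithin] with u hu
  have hx := inv_sq_mem_Ioo hu
  have hx1 : 0 < 1 - u⁻¹ ^ 2 := by linarith [hx.2]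
  have hu0 : 0 < u := one_pos.trans hu
  rw [adsG₁_eq_eulerInt hδ hδ1 hμ hu, sq_sub_one_rpow hu, eulerInt_transform hx.1 hx.2,
    show (1 - δ + μ) / 2 - ((δ + μ) / 2 + 1) = -(δ + 1 / 2) by ring, rpow_neg hx1.le,
    sub_eq_add_neg, rpow_add hu0]
  have := (rpow_pos_of_pos hx1 (δ + 1 / 2)).ne'
  simp only [Function.comp_apply]
  generalize (1 - u⁻¹ ^ 2) ^ (δ + 1 / 2) = y1 at *
  generalize eulerInt _ _ _ _ = y2
  generalize π ^ (δ + 1 / 2) = y3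
  field_simp

lemma adsG_reflect {δ μ u : ℝ} (hδ : 0 < δ) (hδ1 : δ < 1) (hμ : 0 < μ) (hu : 1 < u) :
    adsG (2 * δ + 1) μ u = massRatio δ μ * (2 * π) ^ (1 - 2 * δ) * (u ^ 2 - 1) ^ (1 / 2 - δ) *
      adsG (2 * (1 - δ) + 1) μ u := by
  have hx := inv_sq_mem_Ioo hu
  have hu0 : 0 < u := one_pos.trans hu
  have hG1 : Gamma ((δ + μ + 1) / 2) ≠ 0 := (Gamma_pos_of_pos (by positivity)).ne'
  have hG2 : Gamma ((2 - δ + μ) / 2) ≠ 0 := (Gamma_pos_of_pos (by linarith)).ne'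
  have hG3 : Gamma ((1 - δ + μ) / 2) ≠ 0 := (Gamma_pos_of_pos (by linarith)).ne'
  rw [adsG_eq_eulerInt_swap (δ := 1 - δ) (by linarith) (by linarith) hμ hu,
    adsG_eq_eulerInt hδ hδ1 hμ hu, eulerInt_transform hx.1 hx.2, sq_sub_one_rpow hu,
    mul_rpow two_pos.le pi_pos.le,
    show (1 - δ + μ) / 2 - (δ + μ) / 2 = 1 / 2 - δ by ring,
    show (δ + μ + 1) / 2 + (1 - δ + μ) / 2 - (δ + μ) / 2 = (2 - δ + μ) / 2 by ring,
    show (1 - δ + μ + 1) / 2 = (2 - δ + μ) / 2 by ring,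
    show (2 - (1 - δ) + μ) / 2 = (δ + μ + 1) / 2 by ring,
    show -(δ + μ) = 2 * (1 / 2 - δ) + -(1 - δ + μ) by ring, rpow_add hu0,
    show 1 - δ + 1 / 2 = (δ + 1 / 2) + (1 - 2 * δ) by ring, rpow_add pi_pos (δ + 1 / 2)]
  have h := Gamma_ratio_eq_massRatio δ μ
  have h1 : π ^ (δ + 1 / 2) ≠ 0 := by positivity
  have h2 : π ^ (1 - 2 * δ) ≠ 0 := by positivity
  rw [div_eq_iff (by positivity)] at h
  generalize π ^ (δ + 1 / 2) = y1 at *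
  generalize π ^ (1 - 2 * δ) = y2 at *
  generalize (2 : ℝ) ^ (1 - 2 * δ) = y3 at *
  generalize (1 - u⁻¹ ^ 2) ^ (1 / 2 - δ) = y4 at *
  generalize eulerInt ((1 - δ + μ) / 2) ((δ + μ + 1) / 2) ((2 - δ + μ) / 2) (u⁻¹ ^ 2) = y5 at *
  generalize u ^ (2 * (1 / 2 - δ)) = y6 at *
  generalize u ^ (-(1 - δ + μ)) = y7 at *
  generalize Gamma ((δ + μ) / 2) = g1 at *
  generalize Gamma ((δ + μ + 1) / 2) = g2 at *
  generalize Gamma ((1 - δ + μ) / 2) = g3 at *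
  generalize Gamma ((2 - δ + μ) / 2) = g4 at *
  field_simp
  linear_combination y4 * y5 * y6 * y7 * h

lemma adsG_le {δ μ : ℝ} (hδ : 0 < δ) (hδ1 : δ < 1) (hμ : 0 < μ) :
    ∃ C, ∀ u : ℝ, 1 < u →
      adsG (2 * δ + 1) μ u ≤ C * (u ^ (-(δ + μ)) * (1 - u⁻¹ ^ 2) ^ (-(δ ^ 2 / 2))) := by
  refine ⟨Gamma ((δ + μ) / 2) / Gamma ((1 - δ + μ) / 2) * (Gamma ((δ + μ + 1) / 2) *
    Gamma ((1 - δ + μ) / 2 - (δ + μ) / 2 + δ ^ 2 / 2) /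
    Gamma ((δ + μ + 1) / 2 + ((1 - δ + μ) / 2 - (δ + μ) / 2 + δ ^ 2 / 2))) /
    (4 * π ^ (δ + 1 / 2)), fun u hu => ?_⟩
  have hx := inv_sq_mem_Ioo hu
  have hu0 : 0 < u := one_pos.trans hu
  have h := eulerInt_le (p := (δ + μ + 1) / 2) (q := (1 - δ + μ) / 2) (a := (δ + μ) / 2)
    (s := δ ^ 2 / 2) (by positivity) (by positivity) (by nlinarith) (by nlinarith) hx.1 hx.2
  have hG1 : 0 < Gamma ((δ + μ) / 2) := Gamma_pos_of_pos (by positivity)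
  have hG2 : 0 < Gamma ((1 - δ + μ) / 2) := Gamma_pos_of_pos (by linarith)
  rw [adsG_eq_eulerInt hδ hδ1 hμ hu]
  have h2 : 0 ≤ u ^ (-(δ + μ)) * (Gamma ((δ + μ) / 2) / Gamma ((1 - δ + μ) / 2) /
    (4 * π ^ (δ + 1 / 2))) := by positivity
  refine le_of_eq_of_le ?_ ((mul_le_mul_of_nonneg_left h h2).trans_eq ?_) <;> ring

lemma integrableOn_Ioi_rpow_mul_one_sub {ε η : ℝ} (hε : 0 < ε) (hη : η < 1) :
    IntegrableOn (fun u : ℝ => u ^ (-1 - ε) * (1 - u⁻¹ ^ 2) ^ (-η)) (Set.Ioi 1) := by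
  have himg : (fun u : ℝ => u⁻¹ ^ 2) '' Set.Ioi 1 = Set.Ioo 0 1 := by
    refine Set.Subset.antisymm (Set.image_subset_iff.mpr fun u hu => inv_sq_mem_Ioo hu)
      fun x hx => ⟨(√x)⁻¹, ?_, ?_⟩
    · exact one_lt_inv_iff₀.mpr ⟨sqrt_pos.mpr hx.1, by
        rw [Real.sqrt_lt' one_pos]; simpa using hx.2⟩
    · simp [sq_sqrt hx.1.le]
  have hinj : Set.InjOn (fun u : ℝ => u⁻¹ ^ 2) (Set.Ioi 1) := by
    intro u hu v hv h
    have hu0 : (0 : ℝ) < u := one_pos.trans hu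
    have hv0 : (0 : ℝ) < v := one_pos.trans hv
    exact inv_injective ((pow_left_inj₀ (by positivity) (by positivity) two_ne_zero).mp h)
  have hder : ∀ u ∈ Set.Ioi (1 : ℝ),
      HasDerivWithinAt (fun u : ℝ => u⁻¹ ^ 2) (-2 * u⁻¹ ^ 3) (Set.Ioi 1) u := by
    intro u hu
    have hu0 : u ≠ 0 := (one_pos.trans hu).ne'
    convert! ((hasDerivAt_inv hu0).pow 2).hasDerivWithinAt using 1
    simp only [Nat.cast_ofNat, inv_pow]
    field_simp
    simp
  have h := (integrableOn_image_iff_integrableOn_abs_deriv_smul measurableSet_Ioi hder hinj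
    (fun t : ℝ => t ^ (ε / 2 - 1) * (1 - t) ^ (1 - η - 1))).mp (by
      rw [himg]; exact (integrableOn_beta (by positivity) (by linarith)).1)
  refine IntegrableOn.congr_fun (h.const_mul (1 / 2)) (fun u hu => ?_) measurableSet_Ioi
  have hu0 : (0 : ℝ) < u := one_pos.trans hu
  have h1 : u ^ (-1 - ε) = u⁻¹ ^ 3 * (u⁻¹ ^ 2) ^ (ε / 2 - 1) := by
    rw [← rpow_natCast, ← rpow_natCast, ← rpow_mul (by positivity), ← rpow_add (by positivity),
      inv_rpow hu0.le, ← rpow_neg hu0.le]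
    congr 1
    push_cast
    ring
  simp only [smul_eq_mul]
  rw [abs_of_neg (by simp only [neg_mul, Left.neg_neg_iff]; positivity), h1,
    show 1 - η - 1 = -η by ring]
  ring

lemma continuousOn_adsG {δ μ : ℝ} (hδ : 0 < δ) (hμ : 0 < μ) :
    ContinuousOn (adsG (2 * δ + 1) μ) (Set.Ioi 1) := fun _ hu =>
  (hasDerivAt_adsG hδ hμ hu).continuousAt.continuousWithinAt

lemma continuousOn_sq_sub_one_rpow (s : ℝ) :
    ContinuousOn (fun u : ℝ => (u ^ 2 - 1) ^ s) (Set.Ioi 1) := by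
  refine ContinuousOn.rpow_const (by fun_prop) fun u (hu : 1 < u) => Or.inl ?_
  nlinarith

lemma integrableOn_adsG_mul_adsG {δ μ₁ μ₂ : ℝ} (hδ : 0 < δ) (hδ1 : δ < 1) (hμ₁ : 0 < μ₁)
    (hμ₂ : 0 < μ₂) :
    IntegrableOn (fun u : ℝ => adsG (2 * δ + 1) μ₁ u * adsG (2 * δ + 1) μ₂ u *
      (u ^ 2 - 1) ^ (δ - 1 / 2)) (Set.Ioi 1) := by
  obtain ⟨C₁, hC₁⟩ := adsG_le hδ hδ1 hμ₁
  obtain ⟨C₂, hC₂⟩ := adsG_le hδ hδ1 hμ₂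
  have hbd := (integrableOn_Ioi_rpow_mul_one_sub (ε := μ₁ + μ₂)
    (η := 2 * (δ ^ 2 / 2) - (δ - 1 / 2)) (by positivity) (by nlinarith)).const_mul (C₁ * C₂)
  refine Integrable.mono' hbd (ContinuousOn.aestronglyMeasurable (((continuousOn_adsG hδ hμ₁).mul
    (continuousOn_adsG hδ hμ₂)).mul (continuousOn_sq_sub_one_rpow _)) measurableSet_Ioi)
    (ae_restrict_of_forall_mem measurableSet_Ioi fun u hu => ?_)
  have hu0 : (0 : ℝ) < u := one_pos.trans hu
  have hx1 : 0 < 1 - u⁻¹ ^ 2 := by linarith [(inv_sq_mem_Ioo hu).2]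
  have h1 := adsG_pos hδ hμ₁ hu
  have h2 := adsG_pos hδ hμ₂ hu
  rw [sq_sub_one_rpow hu, norm_of_nonneg (by positivity)]
  refine (mul_le_mul_of_nonneg_right (mul_le_mul (hC₁ u hu) (hC₂ u hu) h2.le
    (h1.le.trans (hC₁ u hu))) (by positivity)).trans_eq ?_
  rw [show -1 - (μ₁ + μ₂) = -(δ + μ₁) + -(δ + μ₂) + 2 * (δ - 1 / 2) by ring,
    show -(2 * (δ ^ 2 / 2) - (δ - 1 / 2)) = -(δ ^ 2 / 2) + -(δ ^ 2 / 2) + (δ - 1 / 2) by ring,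
    rpow_add hu0, rpow_add hu0, rpow_add hx1, rpow_add hx1]
  ring

lemma integrableOn_adsG_mul_adsG_mul_adsG {δ μ₁ μ₂ μ₃ : ℝ} (hδ : 0 < δ) (hδ1 : δ < 1)
    (hμ₁ : 0 < μ₁) (hμ₂ : 0 < μ₂) (hμ₃ : 0 < μ₃) :
    IntegrableOn (fun u : ℝ => adsG (2 * δ + 1) μ₁ u * adsG (2 * δ + 1) μ₂ u *
      adsG (2 * δ + 1) μ₃ u * (u ^ 2 - 1) ^ (δ - 1 / 2)) (Set.Ioi 1) := by
  obtain ⟨C₁, hC₁⟩ := adsG_le hδ hδ1 hμ₁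
  obtain ⟨C₂, hC₂⟩ := adsG_le hδ hδ1 hμ₂
  obtain ⟨C₃, hC₃⟩ := adsG_le hδ hδ1 hμ₃
  have hbd := (integrableOn_Ioi_rpow_mul_one_sub (ε := δ + μ₁ + μ₂ + μ₃)
    (η := 3 * (δ ^ 2 / 2) - (δ - 1 / 2)) (by positivity) (by nlinarith)).const_mul (C₁ * C₂ * C₃)
  refine Integrable.mono' hbd (ContinuousOn.aestronglyMeasurable ((((continuousOn_adsG hδ hμ₁).mul
    (continuousOn_adsG hδ hμ₂)).mul (continuousOn_adsG hδ hμ₃)).mul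
    (continuousOn_sq_sub_one_rpow _)) measurableSet_Ioi)
    (ae_restrict_of_forall_mem measurableSet_Ioi fun u hu => ?_)
  have hu0 : (0 : ℝ) < u := one_pos.trans hu
  have hx1 : 0 < 1 - u⁻¹ ^ 2 := by linarith [(inv_sq_mem_Ioo hu).2]
  have h1 := adsG_pos hδ hμ₁ hu
  have h2 := adsG_pos hδ hμ₂ hu
  have h3 := adsG_pos hδ hμ₃ hu
  have h12 := mul_le_mul (hC₁ u hu) (hC₂ u hu) h2.le (h1.le.trans (hC₁ u hu))
  rw [sq_sub_one_rpow hu, norm_of_nonneg (by positivity)]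
  refine (mul_le_mul_of_nonneg_right (mul_le_mul h12 (hC₃ u hu) h3.le
    ((mul_pos h1 h2).le.trans h12)) (by positivity)).trans_eq ?_
  rw [show -1 - (δ + μ₁ + μ₂ + μ₃) =
      -(δ + μ₁) + -(δ + μ₂) + -(δ + μ₃) + 2 * (δ - 1 / 2) by ring,
    show -(3 * (δ ^ 2 / 2) - (δ - 1 / 2)) =
      -(δ ^ 2 / 2) + -(δ ^ 2 / 2) + -(δ ^ 2 / 2) + (δ - 1 / 2) by ring,
    rpow_add hu0, rpow_add hu0, rpow_add hu0, rpow_add hx1, rpow_add hx1, rpow_add hx1]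
  ring

lemma hasDerivAt_wronskian {δ μ₁ μ₂ u : ℝ} (hδ : 0 < δ) (hμ₁ : 0 < μ₁) (hμ₂ : 0 < μ₂)
    (hu : 1 < u) :
    HasDerivAt (fun u : ℝ => (u ^ 2 - 1) ^ (δ + 1 / 2) *
      (adsG (2 * δ + 1) μ₁ u * adsG₁ δ μ₂ u - adsG₁ δ μ₁ u * adsG (2 * δ + 1) μ₂ u))
      ((μ₁ ^ 2 - μ₂ ^ 2) * (adsG (2 * δ + 1) μ₁ u * adsG (2 * δ + 1) μ₂ u *
        (u ^ 2 - 1) ^ (δ - 1 / 2))) u := by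
  have hz : 0 < u ^ 2 - 1 := by nlinarith
  have h1 : HasDerivAt (fun u : ℝ => (u ^ 2 - 1) ^ (δ + 1 / 2))
      (2 * u * (δ + 1 / 2) * (u ^ 2 - 1) ^ (δ - 1 / 2)) u := by
    have h := ((hasDerivAt_pow 2 u).sub_const 1).rpow_const (p := δ + 1 / 2) (Or.inl hz.ne')
    convert! h using 1
    rw [show δ + 1 / 2 - 1 = δ - 1 / 2 by ring]
    simp
  have h2 := h1.mul (((hasDerivAt_adsG hδ hμ₁ hu).mul (hasDerivAt_adsG₁ hδ hμ₂ hu)).sub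
    ((hasDerivAt_adsG₁ hδ hμ₁ hu).mul (hasDerivAt_adsG hδ hμ₂ hu)))
  convert! h2 using 1
  have e1 := adsG_ode hδ hμ₁ hu
  have e2 := adsG_ode hδ hμ₂ hu
  simp only [Pi.mul_apply, Pi.sub_apply]
  rw [show δ + 1 / 2 = δ - 1 / 2 + 1 by ring, rpow_add_one hz.ne']
  linear_combination (u ^ 2 - 1) ^ (δ - 1 / 2) * (adsG (2 * δ + 1) μ₁ u * e2 -
    adsG (2 * δ + 1) μ₂ u * e1)

lemma tendsto_rpow_mul_adsG_mul_adsG₁ {δ μ₁ μ₂ : ℝ} (hδ : 0 < δ) (hμ₁ : 0 < μ₁) (hμ₂ : 0 < μ₂) :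
    Tendsto (fun u : ℝ => (u ^ 2 - 1) ^ (δ + 1 / 2) * (adsG (2 * δ + 1) μ₁ u * adsG₁ δ μ₂ u))
      atTop (nhds 0) := by
  obtain ⟨C₁, hC₁0, hC₁⟩ := adsG_le_of_two_le hδ hμ₁
  obtain ⟨C₂, hC₂0, hC₂⟩ := adsG₁_le_of_two_le hδ hμ₂
  have h0 : Tendsto (fun u : ℝ => C₁ * C₂ * u ^ (-(μ₁ + μ₂))) atTop (nhds 0) := by
    simpa using (tendsto_rpow_neg_atTop (y := μ₁ + μ₂) (by positivity)).const_mul (C₁ * C₂)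
  refine squeeze_zero' ?_ ?_ h0
  · filter_upwards [eventually_ge_atTop 2] with u hu
    have hu1 : 1 < u := by linarith
    have hz : 0 < u ^ 2 - 1 := by nlinarith
    have h1 := adsG_pos hδ hμ₁ hu1
    have h2 := adsG₁_nonneg hδ hμ₂ hu1
    positivity
  · filter_upwards [eventually_ge_atTop 2] with u hu
    have hu1 : 1 < u := by linarith
    have hu0 : 0 < u := by linarith
    have hz : 0 < u ^ 2 - 1 := by nlinarith
    have h1 := adsG_pos hδ hμ₁ hu1
    have h2 := adsG₁_nonneg hδ hμ₂ hu1
    have h3 : (u ^ 2 - 1) ^ (δ + 1 / 2) ≤ u ^ (2 * (δ + 1 / 2)) := by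
      rw [rpow_mul hu0.le]
      exact rpow_le_rpow hz.le (by norm_num) (by positivity)
    calc _ ≤ u ^ (2 * (δ + 1 / 2)) * (C₁ * u ^ (-(δ + μ₁)) * (C₂ * u ^ (-(δ + μ₂ + 1)))) :=
          mul_le_mul h3 (mul_le_mul (hC₁ u hu) (hC₂ u hu) h2 (by positivity)) (by positivity)
            (by positivity)
      _ = _ := by
          rw [show -(μ₁ + μ₂) = 2 * (δ + 1 / 2) + -(δ + μ₁) + -(δ + μ₂ + 1) by ring,
            rpow_add hu0, rpow_add hu0]
          ring

/-- The one-loop bubble with two different masses, below the first critical dimension. -/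
lemma integral_adsG_mul_adsG_of_lt_half {δ μ₁ μ₂ : ℝ} (hδ : 0 < δ) (hδ1 : δ < 1 / 2)
    (hμ₁ : 0 < μ₁) (hμ₂ : 0 < μ₂) :
    (μ₁ ^ 2 - μ₂ ^ 2) * ∫ u in Set.Ioi (1 : ℝ), adsG (2 * δ + 1) μ₁ u * adsG (2 * δ + 1) μ₂ u *
      (u ^ 2 - 1) ^ (δ - 1 / 2) =
      Gamma (δ + 1 / 2) * Gamma (1 / 2 - δ) * 2 ^ (1 - 2 * δ) / (8 * π ^ (2 * δ + 1)) *
        (massRatio δ μ₂ - massRatio δ μ₁) := by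
  have hbd := (integrableOn_adsG_mul_adsG hδ (by linarith) hμ₁ hμ₂).const_mul (μ₁ ^ 2 - μ₂ ^ 2)
  have h1 := ((tendsto_adsG hδ hδ1 hμ₁).mul (tendsto_adsG₁ hδ (by linarith) hμ₂)).sub
    ((tendsto_adsG hδ hδ1 hμ₂).mul (tendsto_adsG₁ hδ (by linarith) hμ₁))
  have h2 := (tendsto_rpow_mul_adsG_mul_adsG₁ hδ hμ₁ hμ₂).sub
    (tendsto_rpow_mul_adsG_mul_adsG₁ hδ hμ₂ hμ₁)
  have h := integral_Ioi_deriv_mul_eq_sub (v := fun _ => 1) (v' := fun _ => 0)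
    (fun u hu => hasDerivAt_wronskian hδ hμ₁ hμ₂ hu) (fun u _ => hasDerivAt_const u 1)
    (hbd.congr (Eventually.of_forall fun u => by simp))
    (h1.congr fun u => by simp only [Pi.mul_apply]; ring)
    (h2.congr fun u => by simp only [Pi.mul_apply]; ring)
  simp only [mul_one, mul_zero, add_zero, sub_zero, integral_const_mul] at h
  have hpi : π ^ (2 * δ + 1) = π ^ (δ + 1 / 2) * π ^ (δ + 1 / 2) := by
    rw [← rpow_add pi_pos]
    ring_nf
  rw [h, hpi]
  generalize π ^ (δ + 1 / 2) = y
  ring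

/-- The one-loop bubble with two different masses. -/
lemma integral_adsG_mul_adsG {δ μ₁ μ₂ : ℝ} (hδ : 0 < δ) (hδ1 : δ < 1) (hδ2 : δ ≠ 1 / 2)
    (hμ₁ : 0 < μ₁) (hμ₂ : 0 < μ₂) :
    (μ₁ ^ 2 - μ₂ ^ 2) * ∫ u in Set.Ioi (1 : ℝ), adsG (2 * δ + 1) μ₁ u * adsG (2 * δ + 1) μ₂ u *
      (u ^ 2 - 1) ^ (δ - 1 / 2) =
      Gamma (δ + 1 / 2) * Gamma (1 / 2 - δ) * 2 ^ (1 - 2 * δ) / (8 * π ^ (2 * δ + 1)) *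
        (massRatio δ μ₂ - massRatio δ μ₁) := by
  rcases hδ2.lt_or_gt with hlt | hgt
  · exact integral_adsG_mul_adsG_of_lt_half hδ hlt hμ₁ hμ₂
  have h := integral_adsG_mul_adsG_of_lt_half (δ := 1 - δ) (by linarith) (by linarith) hμ₁ hμ₂
  have he : ∫ u in Set.Ioi (1 : ℝ), adsG (2 * δ + 1) μ₁ u * adsG (2 * δ + 1) μ₂ u *
      (u ^ 2 - 1) ^ (δ - 1 / 2) = massRatio δ μ₁ * massRatio δ μ₂ *
      ((2 * π) ^ (1 - 2 * δ)) ^ 2 * ∫ u in Set.Ioi (1 : ℝ), adsG (2 * (1 - δ) + 1) μ₁ u *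
      adsG (2 * (1 - δ) + 1) μ₂ u * (u ^ 2 - 1) ^ (1 - δ - 1 / 2) := by
    rw [← integral_const_mul]
    refine setIntegral_congr_fun measurableSet_Ioi fun u (hu : 1 < u) => ?_
    have hz : 0 < u ^ 2 - 1 := by nlinarith
    have hz1 : (u ^ 2 - 1) ^ (1 / 2 - δ) * (u ^ 2 - 1) ^ (δ - 1 / 2) = 1 := by
      rw [← rpow_add hz, show 1 / 2 - δ + (δ - 1 / 2) = 0 by ring, rpow_zero]
    rw [adsG_reflect hδ hδ1 hμ₁ hu, adsG_reflect hδ hδ1 hμ₂ hu,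
      show 1 - δ - 1 / 2 = 1 / 2 - δ by ring]
    linear_combination massRatio δ μ₁ * massRatio δ μ₂ * ((2 * π) ^ (1 - 2 * δ)) ^ 2 *
      adsG (2 * (1 - δ) + 1) μ₁ u * adsG (2 * (1 - δ) + 1) μ₂ u *
      (u ^ 2 - 1) ^ (1 / 2 - δ) * hz1
  have hf₁ := (massRatio_pos hδ hδ1 hμ₁).ne'
  have hf₂ := (massRatio_pos hδ hδ1 hμ₂).ne'
  have hG1 : Gamma (δ + 1 / 2) = (δ - 1 / 2) * Gamma (δ - 1 / 2) := by
    rw [← Gamma_add_one (by linarith)]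
    ring_nf
  have hG2 : Gamma (1 - δ + 1 / 2) = (1 / 2 - δ) * Gamma (1 / 2 - δ) := by
    rw [← Gamma_add_one (by linarith)]
    ring_nf
  have hpow : ((2 * π) ^ (1 - 2 * δ)) ^ 2 * (2 ^ (1 - 2 * (1 - δ)) / (8 * π ^ (2 * (1 - δ) + 1))) =
      (2 : ℝ) ^ (1 - 2 * δ) / (8 * π ^ (2 * δ + 1)) := by
    have e2 : (2 : ℝ) ^ (1 - 2 * (1 - δ)) = (2 ^ (1 - 2 * δ))⁻¹ := by
      rw [← rpow_neg two_pos.le]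
      ring_nf
    have e3 : π ^ (2 * (1 - δ) + 1) = π ^ (2 * δ + 1) * (π ^ (1 - 2 * δ)) ^ 2 := by
      rw [sq, ← rpow_add pi_pos, ← rpow_add pi_pos]
      ring_nf
    have n1 : (2 : ℝ) ^ (1 - 2 * δ) ≠ 0 := by positivity
    have n2 : π ^ (1 - 2 * δ) ≠ 0 := by positivity
    have n3 : π ^ (2 * δ + 1) ≠ 0 := by positivity
    rw [e2, e3, mul_rpow two_pos.le pi_pos.le]
    generalize (2 : ℝ) ^ (1 - 2 * δ) = y1 at *
    generalize π ^ (1 - 2 * δ) = y2 at *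
    generalize π ^ (2 * δ + 1) = y3 at *
    field_simp
  rw [massRatio_one_sub, massRatio_one_sub, hG2,
    show 1 / 2 - (1 - δ) = δ - 1 / 2 by ring] at h
  rw [he, hG1]
  have hff : massRatio δ μ₁ * massRatio δ μ₂ * ((massRatio δ μ₂)⁻¹ - (massRatio δ μ₁)⁻¹) =
      massRatio δ μ₁ - massRatio δ μ₂ := by
    field_simp
  linear_combination massRatio δ μ₁ * massRatio δ μ₂ * ((2 * π) ^ (1 - 2 * δ)) ^ 2 * h +
    ((2 * π) ^ (1 - 2 * δ)) ^ 2 * (1 / 2 - δ) * Gamma (1 / 2 - δ) * Gamma (δ - 1 / 2) *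
      (2 ^ (1 - 2 * (1 - δ)) / (8 * π ^ (2 * (1 - δ) + 1))) * hff +
    (1 / 2 - δ) * Gamma (1 / 2 - δ) * Gamma (δ - 1 / 2) *
      (massRatio δ μ₁ - massRatio δ μ₂) * hpow

lemma hasSum_integral_klRho_mul_adsG {δ l v κ : ℝ} (hδ : 0 < δ) (hδ1 : δ < 1) (hl : 0 < l)
    (hv : 0 < v) (hκ : 0 < κ) :
    HasSum (fun k : ℕ => klRho δ k l v * ∫ u in Set.Ioi (1 : ℝ),
        adsG (2 * δ + 1) (δ + l + v + 2 * k) u * adsG (2 * δ + 1) κ u * (u ^ 2 - 1) ^ (δ - 1 / 2))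
      (∫ u in Set.Ioi (1 : ℝ), adsG (2 * δ + 1) l u * adsG (2 * δ + 1) v u * adsG (2 * δ + 1) κ u *
        (u ^ 2 - 1) ^ (δ - 1 / 2)) := by
  set F : ℕ → ℝ → ℝ := fun k u => klRho δ k l v * (adsG (2 * δ + 1) (δ + l + v + 2 * k) u *
    adsG (2 * δ + 1) κ u * (u ^ 2 - 1) ^ (δ - 1 / 2)) with hF
  have hFi : ∀ k, IntegrableOn (F k) (Set.Ioi 1) := fun k =>
    (integrableOn_adsG_mul_adsG hδ hδ1 (by positivity) hκ).const_mul _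
  have hF0 : ∀ k, ∀ u ∈ Set.Ioi (1 : ℝ), 0 ≤ F k u := fun k u hu => by
    have h1 := klRho_pos hδ hl hv k
    have h2 := adsG_pos (μ := δ + l + v + 2 * k) hδ (by positivity) hu
    have h3 := adsG_pos hδ hκ hu
    have h4 : 0 ≤ u ^ 2 - 1 := by nlinarith [Set.mem_Ioi.mp hu]
    positivity
  have hFs : ∀ u ∈ Set.Ioi (1 : ℝ), HasSum (fun k => F k u) (adsG (2 * δ + 1) l u *
      adsG (2 * δ + 1) v u * adsG (2 * δ + 1) κ u * (u ^ 2 - 1) ^ (δ - 1 / 2)) := fun u hu => by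
    have h := ((hasSum_klRho_mul_adsG hδ hl hv hu).mul_right (adsG (2 * δ + 1) κ u)).mul_right
      ((u ^ 2 - 1) ^ (δ - 1 / 2))
    convert! h using 1
    funext k
    simp only [hF]
    ring
  have hnorm : ∀ k, ∫ u in Set.Ioi (1 : ℝ), ‖F k u‖ = ∫ u in Set.Ioi (1 : ℝ), F k u := fun k =>
    setIntegral_congr_fun measurableSet_Ioi fun u hu => norm_of_nonneg (hF0 k u hu)
  have hsum : Summable fun k => ∫ u in Set.Ioi (1 : ℝ), ‖F k u‖ := by
    refine summable_of_sum_range_le (c := ∫ u in Set.Ioi (1 : ℝ), adsG (2 * δ + 1) l u *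
      adsG (2 * δ + 1) v u * adsG (2 * δ + 1) κ u * (u ^ 2 - 1) ^ (δ - 1 / 2))
      (fun k => integral_nonneg fun u => norm_nonneg _) fun n => ?_
    simp only [hnorm]
    rw [← integral_finsetSum _ fun k _ => hFi k]
    refine setIntegral_mono_on (integrable_finsetSum _ fun k _ => hFi k)
      (integrableOn_adsG_mul_adsG_mul_adsG hδ hδ1 hl hv hκ) measurableSet_Ioi fun u hu => ?_
    exact sum_le_hasSum _ (fun k _ => hF0 k u hu) (hFs u hu)
  have h := hasSum_integral_of_summable_integral_norm hFi hsum
  rw [setIntegral_congr_fun measurableSet_Ioi fun u hu => (hFs u hu).tsum_eq] at h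
  convert! h using 1
  funext k
  rw [integral_const_mul]

/-- The two-loop banana ("watermelon") integral with three independent masses. -/
theorem two_loop_watermelon (d lam nu kap : ℝ) (hd1 : 1 < d) (hd3 : d < 3) (hd2 : d ≠ 2)
    (hlam : 0 < lam) (hnu : 0 < nu) (hkap : 0 < kap)
    (hres : ∀ k : ℕ, kap ≠ (d - 1) / 2 + lam + nu + 2 * k) :
    IntegrableOn
      (fun u : ℝ =>
        adsG d lam u * adsG d nu u * adsG d kap u * (u ^ 2 - 1) ^ ((d - 2) / 2))
      (Set.Ioi 1) ∧
    Summable (fun k : ℕ =>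
      |klWeight d k lam nu *
          (Real.Gamma (1 - d / 2) /
            (2 ^ d * Real.pi ^ (d / 2) * (((d - 1) / 2 + 2 * k + lam + nu) ^ 2 - kap ^ 2))) *
          (Real.Gamma ((d - 1) / 2 + kap) / Real.Gamma ((3 - d) / 2 + kap) -
            Real.Gamma (d - 1 + 2 * k + lam + nu) / Real.Gamma (1 + 2 * k + lam + nu))|) ∧
    (2 * Real.pi ^ (d / 2) / Real.Gamma (d / 2)) *
        ∫ u in Set.Ioi (1 : ℝ),
          adsG d lam u * adsG d nu u * adsG d kap u * (u ^ 2 - 1) ^ ((d - 2) / 2) =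
      ∑' k : ℕ,
        klWeight d k lam nu *
          (Real.Gamma (1 - d / 2) /
            (2 ^ d * Real.pi ^ (d / 2) * (((d - 1) / 2 + 2 * k + lam + nu) ^ 2 - kap ^ 2))) *
          (Real.Gamma ((d - 1) / 2 + kap) / Real.Gamma ((3 - d) / 2 + kap) -
            Real.Gamma (d - 1 + 2 * k + lam + nu) / Real.Gamma (1 + 2 * k + lam + nu)) := by
  obtain ⟨δ, rfl⟩ : ∃ δ, d = 2 * δ + 1 := ⟨(d - 1) / 2, by ring⟩
  have hδ : 0 < δ := by linarith
  have hδ1 : δ < 1 := by linarith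
  have hδ2 : δ ≠ 1 / 2 := fun h => hd2 (by rw [h]; norm_num)
  have e1 : (2 * δ + 1 - 1) / 2 = δ := by ring
  have e2 : (2 * δ + 1 - 2) / 2 = δ - 1 / 2 := by ring
  have e3 : (2 * δ + 1) / 2 = δ + 1 / 2 := by ring
  have e4 : (3 - (2 * δ + 1)) / 2 = 1 - δ := by ring
  have e5 : 2 * δ + 1 - 1 = 2 * δ := by ring
  have e6 : 1 - (δ + 1 / 2) = 1 / 2 - δ := by ring
  have e7 : 2 * δ / 2 = δ := by ring
  have hw : ∀ k : ℕ, klWeight (2 * δ + 1) k lam nu = klRho δ k lam nu := fun k => by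
    rw [klWeight, klRho, e1]
  have hterm : ∀ k : ℕ, klRho δ k lam nu *
      (Gamma (1 / 2 - δ) / (2 ^ (2 * δ + 1) * π ^ (δ + 1 / 2) *
        ((δ + 2 * k + lam + nu) ^ 2 - kap ^ 2))) *
      (Gamma (δ + kap) / Gamma (1 - δ + kap) -
        Gamma (2 * δ + 2 * k + lam + nu) / Gamma (1 + 2 * k + lam + nu)) =
      2 * π ^ (δ + 1 / 2) / Gamma (δ + 1 / 2) * (klRho δ k lam nu * ∫ u in Set.Ioi (1 : ℝ),
        adsG (2 * δ + 1) (δ + lam + nu + 2 * k) u * adsG (2 * δ + 1) kap u *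
          (u ^ 2 - 1) ^ (δ - 1 / 2)) := fun k => by
    have hne : (δ + lam + nu + 2 * k) ^ 2 - kap ^ 2 ≠ 0 := by
      have h1 : δ + lam + nu + 2 * k - kap ≠ 0 := fun h => hres k (by rw [e1]; linarith)
      have h2 : 0 < δ + lam + nu + 2 * k + kap := by positivity
      rw [sq_sub_sq]
      exact mul_ne_zero h2.ne' h1
    have h := integral_adsG_mul_adsG (μ₁ := δ + lam + nu + 2 * k) hδ hδ1 hδ2 (by positivity) hkap
    rw [massRatio, massRatio, mul_comm, ← eq_div_iff hne] at h
    have hG : Gamma (δ + 1 / 2) ≠ 0 := (Gamma_pos_of_pos (by positivity)).ne'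
    have hpi : π ^ (2 * δ + 1) = π ^ (δ + 1 / 2) * π ^ (δ + 1 / 2) := by
      rw [← rpow_add pi_pos]
      ring_nf
    have h2 : (2 : ℝ) ^ (1 - 2 * δ) = 4 / 2 ^ (2 * δ + 1) := by
      rw [show 1 - 2 * δ = 2 - (2 * δ + 1) by ring, rpow_sub two_pos]
      norm_num
    rw [h, hpi, h2, show δ + 2 * k + lam + nu = δ + lam + nu + 2 * k by ring,
      show δ + (δ + lam + nu + 2 * k) = 2 * δ + 2 * k + lam + nu by ring,
      show 1 - δ + (δ + lam + nu + 2 * k) = 1 + 2 * k + lam + nu by ring]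
    have hy1 : π ^ (δ + 1 / 2) ≠ 0 := by positivity
    have hy2 : (2 : ℝ) ^ (2 * δ + 1) ≠ 0 := by positivity
    generalize (δ + lam + nu + 2 * k) ^ 2 - kap ^ 2 = z at *
    generalize π ^ (δ + 1 / 2) = y1 at *
    generalize (2 : ℝ) ^ (2 * δ + 1) = y2 at *
    generalize Gamma (δ + 1 / 2) = g at *
    generalize Gamma (δ + kap) / Gamma (1 - δ + kap) -
      Gamma (2 * δ + 2 * k + lam + nu) / Gamma (1 + 2 * k + lam + nu) = y3
    field_simp
    ring
  simp only [hw, e2, e3, e4, e5, e6, e7, hterm]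
  have hsum := (hasSum_integral_klRho_mul_adsG hδ hδ1 hlam hnu hkap).mul_left
    (2 * π ^ (δ + 1 / 2) / Gamma (δ + 1 / 2))
  exact ⟨integrableOn_adsG_mul_adsG_mul_adsG hδ hδ1 hlam hnu hkap, hsum.summable.abs,
    hsum.tsum_eq.symm⟩
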